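/- arXiv:1409.5514 — 3 statements merged into one kernel-verified Lean document; each statement's English description precedes it below -/
import Mathlib

section
/- Sufficient condition for solvability: Assume σ̄ m₀ < σ̲. Let P ∈ ℝ^N and assume there exists a ℤ^N-periodic function ψ ∈ C¹(ℝ^N) such that Dψ(x) = −P for every x ∈ ℝ^N with σ(x) ≠ σ̲. Then P ∈ D, i.e., the cell problem H(x, Du + P) = a on T^N admits a solution. -/
open Set Filter MeasureTheory

noncomputable section

abbrev Euc (N : ℕ) := EuclideanSpace ℝ (Fin N)

def intVec {N : ℕ} (z : Fin N → ℤ) : Euc N :=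
  (EuclideanSpace.equiv (Fin N) ℝ).symm (fun i => (z i : ℝ))

def IsZPeriodic {N : ℕ} (u : Euc N → ℝ) : Prop :=
  ∀ (x : Euc N) (z : Fin N → ℤ), u (x + intVec z) = u x

def IsZPeriodicH {N : ℕ} (H : Euc N → Euc N → ℝ) : Prop :=
  ∀ (x p : Euc N) (z : Fin N → ℤ), H (x + intVec z) p = H x p

def superDiff {N : ℕ} (u : Euc N → ℝ) (x : Euc N) : Set (Euc N) :=
  { q | ∃ φ : Euc N → ℝ, ContDiff ℝ 1 φ ∧ IsZPeriodic φ ∧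
        (∀ y, u y - φ y ≤ u x - φ x) ∧ q = gradient φ x }

def subDiff {N : ℕ} (u : Euc N → ℝ) (x : Euc N) : Set (Euc N) :=
  { q | ∃ φ : Euc N → ℝ, ContDiff ℝ 1 φ ∧ IsZPeriodic φ ∧
        (∀ y, u x - φ x ≤ u y - φ y) ∧ q = gradient φ x }

def IsCellSubsolution {N : ℕ} (H : Euc N → Euc N → ℝ) (P : Euc N) (a : ℝ) (u : Euc N → ℝ) : Prop :=
  ∀ x, ∀ q ∈ superDiff u x, H x (q + P) ≤ a

def IsCellSupersolution {N : ℕ} (H : Euc N → Euc N → ℝ) (P : Euc N) (a : ℝ) (u : Euc N → ℝ) : Prop :=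
  ∀ x, ∀ q ∈ subDiff u x, a ≤ H x (q + P)

def IsCellSolution {N : ℕ} (H : Euc N → Euc N → ℝ) (P : Euc N) (u : Euc N → ℝ) (a : ℝ) : Prop :=
  (∃ K : NNReal, LipschitzWith K u) ∧ IsZPeriodic u ∧
    IsCellSubsolution H P a u ∧ IsCellSupersolution H P a u

def IsCoerciveH {N : ℕ} (H : Euc N → Euc N → ℝ) : Prop :=
  ∀ C : ℝ, ∃ r : ℝ, ∀ x p : Euc N, r ≤ ‖p‖ → C ≤ H x p

open Topology

section LipAt

variable {E : Type*} [NormedAddCommGroup E]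

/-- The pointwise Lipschitz constant of `w` at `x` is at most `M`. -/
def LipAt (w : E → ℝ) (x : E) (M : ℝ) : Prop :=
  ∀ ε > 0, ∀ᶠ y in 𝓝 x, |w y - w x| ≤ (M + ε) * ‖y - x‖

lemma LipAt.mono {w : E → ℝ} {x : E} {M M' : ℝ} (h : LipAt w x M) (hM : M ≤ M') :
    LipAt w x M' := fun ε hε => (h ε hε).mono fun y hy => hy.trans (by gcongr)

lemma LipAt.of_forall_gt {w : E → ℝ} {x : E} {M : ℝ} (h : ∀ M' > M, LipAt w x M') :
    LipAt w x M := fun ε hε =>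
  (h (M + ε / 2) (by linarith) (ε / 2) (by linarith)).mono fun y hy => hy.trans_eq (by ring)

lemma LipAt.congr {w v : E → ℝ} {x : E} {M : ℝ} (h : LipAt w x M) (hv : v =ᶠ[𝓝 x] w) :
    LipAt v x M := fun ε hε => by
  filter_upwards [h ε hε, hv] with y hy hvy
  rwa [hvy, hv.self_of_nhds]

lemma LipAt.max {w v : E → ℝ} {x : E} {M : ℝ} (hw : LipAt w x M) (hv : LipAt v x M) :
    LipAt (fun y => max (w y) (v y)) x M := fun ε hε => by
  filter_upwards [hw ε hε, hv ε hε] with y h1 h2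
  exact (abs_max_sub_max_le_max _ _ _ _).trans (max_le h1 h2)

lemma LipAt.average {w v : E → ℝ} {x : E} {M M' : ℝ} (hw : LipAt w x M) (hv : LipAt v x M') :
    LipAt (fun y => (w y + v y) / 2) x ((M + M') / 2) := fun ε hε => by
  filter_upwards [hw ε hε, hv ε hε] with y h1 h2
  rw [abs_le] at *
  constructor <;> linarith

lemma LipAt.comp_add_right {w : E → ℝ} {x a : E} {M : ℝ} (h : LipAt w (x + a) M) :
    LipAt (fun y => w (y + a)) x M := fun ε hε => by
  have : Tendsto (fun y => y + a) (𝓝 x) (𝓝 (x + a)) :=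
    (continuous_id.add continuous_const).tendsto x
  simpa using this.eventually (h ε hε)

lemma LipAt.continuousAt {w : E → ℝ} {x : E} {M : ℝ} (h : LipAt w x M) : ContinuousAt w x := by
  rw [ContinuousAt, tendsto_iff_norm_sub_tendsto_zero]
  have h1 : Tendsto (fun y => (M + 1) * ‖y - x‖) (𝓝 x) (𝓝 0) := by
    have : Continuous fun y : E => (M + 1) * ‖y - x‖ := by fun_prop
    simpa using this.tendsto x
  exact squeeze_zero' (Eventually.of_forall fun _ => norm_nonneg _) (h 1 one_pos) h1

lemma LipAt.of_ball {w : E → ℝ} {x : E} {r M : ℝ} (hr : 0 < r)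
    (h : ∀ y ∈ Metric.ball x r, |w y - w x| ≤ M * ‖y - x‖) : LipAt w x M := fun ε hε => by
  filter_upwards [Metric.ball_mem_nhds x hr] with y hy
  exact (h y hy).trans (by gcongr; linarith)

variable [NormedSpace ℝ E]

lemma LipAt.nonneg [Nontrivial E] {w : E → ℝ} {x : E} {M : ℝ} (h : LipAt w x M) : 0 ≤ M := by
  by_contra! hM
  have : (𝓝[≠] x).NeBot := Module.punctured_nhds_neBot ℝ E x
  obtain ⟨y, hy, hne⟩ := (((h (-M / 2) (by linarith)).filter_mono nhdsWithin_le_nhds).and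
    (self_mem_nhdsWithin : ∀ᶠ y in 𝓝[≠] x, y ∈ ({x}ᶜ : Set E))).exists
  have h1 : 0 < ‖y - x‖ := norm_sub_pos_iff.2 hne
  have := abs_nonneg (w y - w x)
  nlinarith

lemma abs_sub_le_of_lipAt {s : Set E} (hs : Convex ℝ s) {w : E → ℝ} {M : ℝ}
    (h : ∀ x ∈ s, LipAt w x M) {y z : E} (hy : y ∈ s) (hz : z ∈ s) :
    |w z - w y| ≤ M * ‖z - y‖ := by
  rcases eq_or_ne z y with rfl | hne
  · simp
  have hpos : 0 < ‖z - y‖ := norm_sub_pos_iff.2 hne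
  set γ : ℝ → E := fun t => y + t • (z - y)
  have hγs : ∀ t ∈ Icc (0:ℝ) 1, γ t ∈ s := fun t ht => by
    have := hs.add_smul_sub_mem hy hz ht
    simpa [γ] using this
  have hγc : Continuous γ := by fun_prop
  have hγd : ∀ t τ : ℝ, γ τ - γ t = (τ - t) • (z - y) := fun t τ => by
    simp only [γ, sub_smul]; abel
  refine le_of_forall_pos_le_add fun ε hε => ?_
  have key := image_norm_le_of_liminf_right_slope_norm_lt_deriv_boundary (a := 0) (b := 1)
    (f := fun t => w (γ t) - w y) (f' := fun _ => M * ‖z - y‖)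
    (B := fun t => (M * ‖z - y‖ + ε) * t) (B' := fun _ => M * ‖z - y‖ + ε) ?_ ?_ ?_ ?_ ?_ ?_
    (right_mem_Icc.2 zero_le_one)
  · simpa [γ] using key
  · intro t ht
    refine ContinuousAt.continuousWithinAt ?_
    exact (((h _ (hγs t ht)).continuousAt).comp hγc.continuousAt).sub continuousAt_const
  · intro t ht r hr
    refine Eventually.frequently ?_
    set η := (r - M * ‖z - y‖) / (2 * ‖z - y‖) with hη
    have hηpos : 0 < η := div_pos (sub_pos.2 hr) (by positivity)
    have hηr : (M + η) * ‖z - y‖ < r := by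
      have : η * ‖z - y‖ = (r - M * ‖z - y‖) / 2 := by rw [hη]; field_simp
      rw [add_mul, this]; linarith
    have h1 := (hγc.tendsto t).eventually (h _ (hγs t ⟨ht.1, ht.2.le⟩) η hηpos)
    filter_upwards [h1.filter_mono nhdsWithin_le_nhds, self_mem_nhdsWithin] with τ hτ hgt
    have hgt' : 0 < τ - t := sub_pos.2 hgt
    rw [hγd, norm_smul, Real.norm_of_nonneg hgt'.le] at hτ
    rw [slope_def_field, div_lt_iff₀ hgt']
    have h2 : ‖w (γ τ) - w y‖ - ‖w (γ t) - w y‖ ≤ |w (γ τ) - w (γ t)| := by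
      simpa using norm_sub_norm_le (w (γ τ) - w y) (w (γ t) - w y)
    simp only [Function.comp_apply]
    nlinarith
  · simp [γ]
  · fun_prop
  · intro t _
    simpa using ((hasDerivAt_id t).const_mul (M * ‖z - y‖ + ε)).hasDerivWithinAt
  · intro t _ _
    linarith

end LipAt

section Gradient

variable {E : Type*} [NormedAddCommGroup E] [InnerProductSpace ℝ E] [CompleteSpace E]

lemma HasGradientAt.lipAt {g : E → ℝ} {q x : E} (h : HasGradientAt g q x) : LipAt g x ‖q‖ :=
  fun ε hε => by
  filter_upwards [(hasGradientAt_iff_isLittleO.1 h).def hε] with y hy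
  have h1 := abs_real_inner_le_norm q (y - x)
  rw [Real.norm_eq_abs] at hy
  have h2 := abs_add_le (g y - g x - inner ℝ q (y - x)) (inner ℝ q (y - x))
  rw [sub_add_cancel] at h2
  linarith

lemma norm_le_of_lipAt_of_forall_sub_le {w g : E → ℝ} {q x : E} {M : ℝ}
    (hw : LipAt w x M) (hg : HasGradientAt g q x) (hmax : ∀ y, w y - g y ≤ w x - g x)
    (hM : 0 ≤ M) : ‖q‖ ≤ M := by
  rcases eq_or_ne q 0 with rfl | hq
  · simpa using hM
  have hqpos : 0 < ‖q‖ := norm_pos_iff.2 hq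
  refine le_of_forall_pos_le_add fun ε hε => ?_
  have hε2 : 0 < ε / 2 := by positivity
  have ht : Tendsto (fun t : ℝ => x - t • q) (𝓝[>] 0) (𝓝 x) := by
    have : Continuous fun t : ℝ => x - t • q := by fun_prop
    simpa using (this.tendsto 0).mono_left nhdsWithin_le_nhds
  obtain ⟨t, ⟨h1, h2⟩, htpos⟩ := ((ht.eventually ((hw _ hε2).and
    ((hasGradientAt_iff_isLittleO.1 hg).def hε2))).and self_mem_nhdsWithin).exists
  have htpos : 0 < t := htpos
  have h3 := hmax (x - t • q)
  have hn : ‖x - t • q - x‖ = t * ‖q‖ := by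
    rw [sub_sub_cancel_left, norm_neg, norm_smul, Real.norm_of_nonneg htpos.le]
  have hi : inner ℝ q (x - t • q - x) = -(t * ‖q‖ * ‖q‖) := by
    rw [sub_sub_cancel_left, inner_neg_right, inner_smul_right, real_inner_self_eq_norm_mul_norm]
    ring
  rw [hn] at h1 h2
  rw [hi, Real.norm_eq_abs] at h2
  rw [abs_le] at h1 h2
  have h4 : t * ‖q‖ * ‖q‖ ≤ t * ‖q‖ * (M + ε) := by nlinarith [h1.1, h2.2]
  exact le_of_mul_le_mul_left h4 (by positivity)

end Gradient

section Torus

variable {N : ℕ}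

@[simp] lemma intVec_apply (z : Fin N → ℤ) (i : Fin N) : intVec z i = z i := rfl

lemma intVec_neg (z : Fin N → ℤ) : intVec (-z) = -intVec z := by
  ext i; simp

lemma IsZPeriodic.gradient_add {g : Euc N → ℝ} (hg : IsZPeriodic g) (x : Euc N)
    (z : Fin N → ℤ) : gradient g (x + intVec z) = gradient g x := by
  have h : (fun y => g (y + intVec z)) = g := funext fun y => hg y z
  rw [gradient, gradient, ← fderiv_comp_add_right, h]

lemma ContDiff.continuous_gradient {g : Euc N → ℝ} (hg : ContDiff ℝ 1 g) :
    Continuous (gradient g) :=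
  (InnerProductSpace.toDual ℝ (Euc N)).symm.continuous.comp (hg.continuous_fderiv one_ne_zero)

lemma ContDiff.hasGradientAt {g : Euc N → ℝ} (hg : ContDiff ℝ 1 g) (x : Euc N) :
    HasGradientAt g (gradient g x) x :=
  ((hg.differentiable one_ne_zero) x).hasGradientAt

lemma exists_isCompact_fundamental (N : ℕ) :
    ∃ K : Set (Euc N), IsCompact K ∧ ∀ x, ∃ z, x + intVec z ∈ K := by
  refine ⟨(EuclideanSpace.equiv (Fin N) ℝ).symm '' Set.pi univ fun _ => Icc (0 : ℝ) 1,
    (isCompact_univ_pi fun _ => isCompact_Icc).image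
      (EuclideanSpace.equiv (Fin N) ℝ).symm.continuous, fun x => ?_⟩
  refine ⟨fun i => -⌊x i⌋, fun i => Int.fract (x i), fun i _ =>
    ⟨Int.fract_nonneg _, (Int.fract_lt_one _).le⟩, ?_⟩
  ext i
  simp [Int.fract, sub_eq_add_neg]

/-- A smooth periodic function vanishing exactly on the translates of `x₀`. -/
def torusBump (x₀ x : Euc N) : ℝ := ∑ i, Real.sin (Real.pi * (x i - x₀ i)) ^ 2

lemma torusBump_nonneg (x₀ x : Euc N) : 0 ≤ torusBump x₀ x :=
  Finset.sum_nonneg fun _ _ => sq_nonneg _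

lemma torusBump_self (x₀ : Euc N) : torusBump x₀ x₀ = 0 := by simp [torusBump]

lemma contDiff_torusBump (x₀ : Euc N) : ContDiff ℝ 1 (torusBump x₀) := by
  refine ContDiff.sum fun i _ => ContDiff.pow (Real.contDiff_sin.comp ?_) 2
  exact contDiff_const.mul ((EuclideanSpace.proj (𝕜 := ℝ) i).contDiff.sub contDiff_const)

lemma isZPeriodic_torusBump (x₀ : Euc N) : IsZPeriodic (torusBump x₀) := fun x z => by
  refine Finset.sum_congr rfl fun i _ => ?_
  have : Real.pi * ((x + intVec z) i - x₀ i) = Real.pi * (x i - x₀ i) + z i * Real.pi := by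
    simp; ring
  rw [this, Real.sin_add_int_mul_pi, mul_pow, ← zpow_natCast, ← zpow_mul,
    mul_comm (z i), zpow_mul]
  simp

lemma exists_of_torusBump_eq_zero {x₀ x : Euc N} (h : torusBump x₀ x = 0) :
    ∃ z, x₀ + intVec z = x := by
  have h1 : ∀ i, Real.sin (Real.pi * (x i - x₀ i)) = 0 := fun i => by
    have := (Finset.sum_eq_zero_iff_of_nonneg fun _ _ => sq_nonneg _).1 h i (Finset.mem_univ i)
    simpa using this
  choose z hz using fun i => Real.sin_eq_zero_iff.1 (h1 i)
  refine ⟨z, ?_⟩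
  ext i
  have h2 : (z i : ℝ) = x i - x₀ i :=
    mul_left_cancel₀ Real.pi_ne_zero (by rw [← hz i]; ring)
  simp [h2]

lemma gradient_torusBump_self (x₀ : Euc N) : gradient (torusBump x₀) x₀ = 0 := by
  have : IsLocalMin (torusBump x₀) x₀ := Eventually.of_forall fun y => by
    rw [torusBump_self]; exact torusBump_nonneg _ _
  rw [gradient, this.fderiv_eq_zero, map_zero]

lemma exists_torusBump_gt {x₀ : Euc N} {U : Set (Euc N)} (hU : IsOpen U) (hx₀ : x₀ ∈ U)
    (hper : ∀ x z, x + intVec z ∈ U ↔ x ∈ U) :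
    ∃ ε > 0, ∀ x, torusBump x₀ x ≤ ε → x ∈ U := by
  obtain ⟨K, hK, hKz⟩ := exists_isCompact_fundamental N
  rcases (K \ U).eq_empty_or_nonempty with he | hne
  · refine ⟨1, one_pos, fun x _ => ?_⟩
    obtain ⟨z, hz⟩ := hKz x
    exact (hper x z).1 (sdiff_eq_empty.1 he hz)
  · obtain ⟨y, hy, hmin⟩ := (hK.diff hU).exists_isMinOn hne
      (contDiff_torusBump x₀).continuous.continuousOn
    have hpos : 0 < torusBump x₀ y := by
      refine (torusBump_nonneg _ _).lt_of_ne fun h => hy.2 ?_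
      obtain ⟨z, rfl⟩ := exists_of_torusBump_eq_zero h.symm
      exact (hper _ _).2 hx₀
    refine ⟨torusBump x₀ y / 2, by positivity, fun x hx => ?_⟩
    by_contra hxU
    obtain ⟨z, hz⟩ := hKz x
    have h1 : torusBump x₀ y ≤ torusBump x₀ (x + intVec z) :=
      hmin (⟨hz, fun h => hxU ((hper x z).1 h)⟩ : x + intVec z ∈ K \ U)
    rw [isZPeriodic_torusBump x₀ x z] at h1
    linarith

end Torus

section MetricSub

variable {N : ℕ} {σ : Euc N → ℝ} {m : ℝ → ℝ} {P : Euc N} {a : ℝ} {u : Euc N → ℝ}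

/-- A metric formulation of subsolutions of `σ(x) m(|Du + P|) = a`: the pointwise Lipschitz
constant of `u + ⟨P, ·⟩` at `x` is at most every `M` with `a ≤ σ(x) m(M)`. -/
structure IsMetricSub (σ : Euc N → ℝ) (m : ℝ → ℝ) (P : Euc N) (a : ℝ) (u : Euc N → ℝ) :
    Prop where
  periodic : IsZPeriodic u
  lipAt : ∀ x M, 0 ≤ M → a ≤ σ x * m M → LipAt (fun y => u y + inner ℝ P y) x M

lemma IsMetricSub.mono {b : ℝ} (hu : IsMetricSub σ m P a u) (hab : a ≤ b) :
    IsMetricSub σ m P b u :=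
  ⟨hu.periodic, fun x M hM h => hu.lipAt x M hM (hab.trans h)⟩

lemma IsMetricSub.sub_const (hu : IsMetricSub σ m P a u) (c : ℝ) :
    IsMetricSub σ m P a (fun x => u x - c) := by
  refine ⟨fun x z => by rw [hu.periodic x z], fun x M hM h ε hε => ?_⟩
  filter_upwards [hu.lipAt x M hM h ε hε] with y hy
  convert hy using 2
  ring

lemma IsMetricSub.le_add (hu : IsMetricSub σ m P a u) {s : Set (Euc N)} (hs : Convex ℝ s)
    {M : ℝ} (hM : 0 ≤ M) (h : ∀ x ∈ s, a ≤ σ x * m M) {y z : Euc N} (hy : y ∈ s) (hz : z ∈ s) :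
    u z + inner ℝ P z ≤ u y + inner ℝ P y + M * ‖z - y‖ := by
  have := abs_sub_le_of_lipAt hs (fun x hx => hu.lipAt x M hM (h x hx)) hy hz
  linarith [le_abs_self (u z + inner ℝ P z - (u y + inner ℝ P y))]

lemma isMetricSub_of_ball (hσ : Continuous σ) (hσpos : ∀ x, 0 < σ x)
    (hm : StrictMonoOn m (Ici 0)) (hu : IsZPeriodic u)
    (h : ∀ (x : Euc N) (r M : ℝ), 0 ≤ M → (∀ y ∈ Metric.ball x r, a ≤ σ y * m M) →
      ∀ y ∈ Metric.ball x r, ∀ z ∈ Metric.ball x r,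
        u z + inner ℝ P z ≤ u y + inner ℝ P y + M * ‖z - y‖) :
    IsMetricSub σ m P a u := by
  refine ⟨hu, fun x M hM haM => LipAt.of_forall_gt fun M' hM' => ?_⟩
  have hlt : a < σ x * m M' := haM.trans_lt
    (mul_lt_mul_of_pos_left (hm hM (hM.trans hM'.le) hM') (hσpos x))
  have hev : ∀ᶠ y in 𝓝 x, a < σ y * m M' :=
    (hσ.mul continuous_const).continuousAt.eventually (lt_mem_nhds hlt)
  obtain ⟨r, hr, hball⟩ := Metric.eventually_nhds_iff_ball.1 hev
  have hx := Metric.mem_ball_self (x := x) hr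
  refine LipAt.of_ball hr fun y hy => abs_sub_le_iff.2 ⟨?_, ?_⟩
  · linarith [h x r M' (hM.trans hM'.le) (fun y hy => (hball y hy).le) x hx y hy]
  · have := h x r M' (hM.trans hM'.le) (fun y hy => (hball y hy).le) y hy x hx
    rw [norm_sub_rev] at this
    linarith

lemma isClosed_setOf_isMetricSub (hσ : Continuous σ) (hσpos : ∀ x, 0 < σ x)
    (hm : StrictMonoOn m (Ici 0)) : IsClosed {u | IsMetricSub σ m P a u} := by
  have : {u | IsMetricSub σ m P a u} = {u | IsZPeriodic u} ∩
      {u | ∀ (x : Euc N) (r M : ℝ), 0 ≤ M → (∀ y ∈ Metric.ball x r, a ≤ σ y * m M) →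
      ∀ y ∈ Metric.ball x r, ∀ z ∈ Metric.ball x r,
        u z + inner ℝ P z ≤ u y + inner ℝ P y + M * ‖z - y‖} := by
    ext u
    exact ⟨fun hu => ⟨hu.periodic, fun x r M hM h y hy z hz =>
      hu.le_add (convex_ball x r) hM h hy hz⟩,
      fun hu => isMetricSub_of_ball hσ hσpos hm hu.1 hu.2⟩
  rw [this]
  refine IsClosed.inter ?_ ?_
  · simp only [IsZPeriodic, ofPred_forall]
    exact isClosed_iInter fun x => isClosed_iInter fun z =>
      isClosed_eq (continuous_apply _) (continuous_apply _)
  · simp only [ofPred_forall]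
    exact isClosed_iInter fun x => isClosed_iInter fun r => isClosed_iInter fun M =>
      isClosed_iInter fun _ => isClosed_iInter fun _ => isClosed_iInter fun y =>
      isClosed_iInter fun _ => isClosed_iInter fun z => isClosed_iInter fun _ =>
      isClosed_le (by fun_prop) (by fun_prop)

lemma IsMetricSub.sub_le {R : ℝ} (hu : IsMetricSub σ m P a u) (hR : 0 ≤ R)
    (haR : ∀ x, a ≤ σ x * m R) (y z : Euc N) : u z - u y ≤ (R + ‖P‖) * ‖z - y‖ := by
  have h := hu.le_add convex_univ hR (fun x _ => haR x) (mem_univ y) (mem_univ z)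
  have h2 := neg_le_of_abs_le (abs_real_inner_le_norm P (z - y))
  rw [inner_sub_right] at h2
  linarith

lemma IsMetricSub.lipschitzWith {R : ℝ} (hu : IsMetricSub σ m P a u) (hR : 0 ≤ R)
    (haR : ∀ x, a ≤ σ x * m R) : LipschitzWith (R + ‖P‖).toNNReal u :=
  LipschitzWith.of_le_add_mul _ fun x y => by
    rw [Real.coe_toNNReal _ (by positivity), dist_eq_norm]
    linarith [hu.sub_le hR haR y x]

/-- The largest metric subsolution that vanishes at `y`. -/
def maxSub (σ : Euc N → ℝ) (m : ℝ → ℝ) (P : Euc N) (a : ℝ) (y x : Euc N) : ℝ :=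
  ⨆ v : {v : Euc N → ℝ // IsMetricSub σ m P a v}, (v.1 x - v.1 y)

lemma IsMetricSub.sub_le_maxSub {R : ℝ} (hu : IsMetricSub σ m P a u) (hR : 0 ≤ R)
    (haR : ∀ x, a ≤ σ x * m R) (x y : Euc N) : u x - u y ≤ maxSub σ m P a y x :=
  le_ciSup (f := fun v : {v : Euc N → ℝ // IsMetricSub σ m P a v} => v.1 x - v.1 y)
    ⟨(R + ‖P‖) * ‖x - y‖, by rintro _ ⟨v, rfl⟩; exact v.2.sub_le hR haR y x⟩ ⟨u, hu⟩

lemma maxSub_self (y : Euc N) : maxSub σ m P a y y = 0 := by simp [maxSub]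

lemma IsMetricSub.isMetricSub_maxSub {R : ℝ} (hu : IsMetricSub σ m P a u) (hR : 0 ≤ R)
    (haR : ∀ x, a ≤ σ x * m R) (hσ : Continuous σ) (hσpos : ∀ x, 0 < σ x)
    (hm : StrictMonoOn m (Ici 0)) (y : Euc N) : IsMetricSub σ m P a (maxSub σ m P a y) := by
  have : Nonempty {v : Euc N → ℝ // IsMetricSub σ m P a v} := ⟨⟨u, hu⟩⟩
  refine isMetricSub_of_ball hσ hσpos hm (fun x z => ?_) fun x r M hM h p hp q hq => ?_
  · exact iSup_congr fun v => by rw [v.2.periodic x z]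
  · suffices maxSub σ m P a y q ≤
        maxSub σ m P a y p + inner ℝ P p + M * ‖q - p‖ - inner ℝ P q by linarith
    refine ciSup_le fun v => ?_
    have h1 := v.2.le_add (convex_ball x r) hM h hp hq
    have h2 := v.2.sub_le_maxSub hR haR p y
    linarith

lemma HasGradientAt.add_inner {g : Euc N → ℝ} {q x : Euc N} (hg : HasGradientAt g q x)
    (P : Euc N) : HasGradientAt (fun y => g y + inner ℝ P y) (q + P) x := by
  rw [hasGradientAt_iff_hasFDerivAt] at *
  rw [map_add]
  exact hg.add ((InnerProductSpace.toDual ℝ (Euc N) P).hasFDerivAt)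

lemma IsMetricSub.isCellSubsolution (hu : IsMetricSub σ m P a u)
    (hmc : ContinuousOn m (Ici 0)) (ha : ∀ x, σ x * m 0 ≤ a) :
    IsCellSubsolution (fun x p => σ x * m ‖p‖) P a u := by
  rintro x q ⟨φ, hφ, -, hmax, rfl⟩
  by_contra! hlt
  set p := gradient φ x + P with hp
  have hppos : 0 < ‖p‖ := by
    refine (norm_nonneg _).lt_of_ne fun h => ?_
    rw [← h] at hlt
    exact (ha x).not_gt hlt
  have hev : ∀ᶠ M in 𝓝 ‖p‖, a < σ x * m M :=
    (continuousAt_const.mul (hmc.continuousAt (Ici_mem_nhds hppos))).eventually (lt_mem_nhds hlt)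
  obtain ⟨M, ⟨haM, hM0⟩, hMp⟩ := (((hev.and (lt_mem_nhds hppos)).filter_mono
    (nhdsWithin_le_nhds (s := Iio ‖p‖))).and self_mem_nhdsWithin).exists
  have := norm_le_of_lipAt_of_forall_sub_le (hu.lipAt x M hM0.le haM.le)
    ((hφ.hasGradientAt x).add_inner P) (fun y => by linarith [hmax y]) hM0.le
  exact (this.trans_lt hMp).false

end MetricSub

section Perron

variable {N : ℕ} {σ : Euc N → ℝ} {m : ℝ → ℝ} {P : Euc N} {a : ℝ} {u : Euc N → ℝ}

/-- At `x`, the metric subsolution condition at level `a` holds with a margin `δ`. -/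
def IsStrictAt (σ : Euc N → ℝ) (m : ℝ → ℝ) (P : Euc N) (a δ : ℝ) (u : Euc N → ℝ)
    (x : Euc N) : Prop :=
  ∀ M, 0 ≤ M → a ≤ σ x * m M → LipAt (fun y => u y + inner ℝ P y) x (M - δ)

lemma LipAt.add_intVec {M : ℝ} (hu : IsZPeriodic u) {x : Euc N} (z : Fin N → ℤ)
    (h : LipAt (fun y => u y + inner ℝ P y) (x + intVec z) M) :
    LipAt (fun y => u y + inner ℝ P y) x M := fun ε hε => by
  filter_upwards [h.comp_add_right ε hε] with y hy
  rw [hu y z, hu x z, inner_add_right, inner_add_right] at hy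
  convert hy using 2
  ring

lemma IsStrictAt.of_add_intVec {δ : ℝ} (hσp : IsZPeriodic σ) (hu : IsZPeriodic u) {x : Euc N}
    (z : Fin N → ℤ) (h : IsStrictAt σ m P a δ u (x + intVec z)) : IsStrictAt σ m P a δ u x :=
  fun M hM haM => (h M hM (by rwa [hσp x z])).add_intVec hu z

lemma lipAt_of_contDiff {g : Euc N → ℝ} (hg : ContDiff ℝ 1 g) (x : Euc N) :
    LipAt (fun y => g y + inner ℝ P y) x ‖gradient g x + P‖ :=
  ((hg.hasGradientAt x).add_inner P).lipAt

lemma IsMetricSub.average {v : Euc N → ℝ} (hu : IsMetricSub σ m P a u)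
    (hv : IsMetricSub σ m P a v) : IsMetricSub σ m P a (fun x => (u x + v x) / 2) := by
  refine ⟨fun x z => by rw [hu.periodic, hv.periodic], fun x M hM h ε hε => ?_⟩
  filter_upwards [(hu.lipAt x M hM h).average (hv.lipAt x M hM h) ε hε] with y hy
  convert hy using 2 <;> ring

lemma IsStrictAt.average {v : Euc N → ℝ} {δ : ℝ} {x : Euc N} (hu : IsStrictAt σ m P a δ u x)
    (hv : IsMetricSub σ m P a v) : IsStrictAt σ m P a (δ / 2) (fun x => (u x + v x) / 2) x := by
  intro M hM h ε hε
  filter_upwards [(hu M hM h).average (hv.lipAt x M hM h) ε hε] with y hy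
  convert hy using 2 <;> ring

lemma IsStrictAt.mono {δ δ' : ℝ} {x : Euc N} (hu : IsStrictAt σ m P a δ u x) (h : δ' ≤ δ) :
    IsStrictAt σ m P a δ' u x :=
  fun M hM haM => (hu M hM haM).mono (by linarith)

lemma gradient_sub_torusBump {φ : Euc N → ℝ} (hφ : ContDiff ℝ 1 φ) (x₀ : Euc N) :
    gradient (fun x => φ x - torusBump x₀ x) x₀ = gradient φ x₀ := by
  have h := gradient_torusBump_self x₀
  rw [gradient, LinearIsometryEquiv.map_eq_zero_iff] at h
  rw [gradient, gradient, fderiv_fun_sub ((hφ.differentiable one_ne_zero) x₀)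
    (((contDiff_torusBump x₀).differentiable one_ne_zero) x₀), h, sub_zero]

lemma IsMetricSub.exists_bump (hu : IsMetricSub σ m P a u) (huc : Continuous u)
    (hσ : Continuous σ) (hσp : IsZPeriodic σ) (hσpos : ∀ x, 0 < σ x)
    (hmc : ContinuousOn m (Ici 0)) (hm : StrictMonoOn m (Ici 0)) {φ : Euc N → ℝ}
    (hφ : ContDiff ℝ 1 φ) (hφp : IsZPeriodic φ) {x₀ : Euc N}
    (hmin : ∀ y, u x₀ - φ x₀ ≤ u y - φ y) (hlt : σ x₀ * m ‖gradient φ x₀ + P‖ < a)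
    {κ : ℝ} (hκ : 0 < κ) :
    ∃ v, IsMetricSub σ m P a v ∧ u x₀ < v x₀ ∧ (∀ y, κ < torusBump x₀ y → v y = u y) ∧
      ∃ δ > 0, ∀ᶠ x in 𝓝 x₀, IsStrictAt σ m P a δ v x := by
  set θ : Euc N → ℝ := fun x => φ x - torusBump x₀ x
  have hθ1 : ContDiff ℝ 1 θ := hφ.sub (contDiff_torusBump x₀)
  have hθp : IsZPeriodic θ := fun x z => by
    simp only [θ]; rw [hφp x z, isZPeriodic_torusBump x₀ x z]
  have hFc : Continuous fun p : Euc N × ℝ => σ p.1 * m (‖gradient θ p.1 + P‖ + |p.2|) := by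
    have h1 := hθ1.continuous_gradient
    refine (hσ.comp continuous_fst).mul (hmc.comp_continuous (by fun_prop) fun p => ?_)
    exact mem_Ici.2 (by positivity)
  obtain ⟨δ, hδ, hδpos⟩ : ∃ δ : ℝ, σ x₀ * m (‖gradient θ x₀ + P‖ + |δ|) < a ∧ 0 < δ := by
    have h0 : ∀ᶠ δ : ℝ in 𝓝 0, σ x₀ * m (‖gradient θ x₀ + P‖ + |δ|) < a := by
      refine (hFc.comp (Continuous.prodMk_right x₀)).continuousAt.eventually (gt_mem_nhds ?_)
      simpa [θ, gradient_sub_torusBump hφ] using hlt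
    exact ((h0.filter_mono (nhdsWithin_le_nhds (s := Ioi 0))).and self_mem_nhdsWithin).exists
  rw [abs_of_pos hδpos] at hδ
  set U : Set (Euc N) := {x | σ x * m (‖gradient θ x + P‖ + δ) < a} with hU
  have hUo : IsOpen U := by
    have := hFc.comp (Continuous.prodMk_left δ)
    simp only [Function.comp_def, abs_of_pos hδpos] at this
    exact isOpen_lt this continuous_const
  have hUlip : ∀ x ∈ U, ∀ M, 0 ≤ M → a ≤ σ x * m M →
      LipAt (fun y => θ y + inner ℝ P y) x (M - δ) := fun x hx M hM haM => by
    refine (lipAt_of_contDiff hθ1 x).mono ?_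
    have h1 := lt_of_mul_lt_mul_left (lt_of_lt_of_le hx haM) (hσpos x).le
    have h2 := (hm.lt_iff_lt (mem_Ici.2 (by positivity)) hM).1 h1
    linarith
  obtain ⟨ε₀, hε₀, hε₀U⟩ := exists_torusBump_gt hUo hδ fun x z => by
    simp only [hU, mem_ofPred_eq, hσp x z, hθp.gradient_add x z]
  set ε := min ε₀ κ with hε
  have hεpos : 0 < ε := lt_min hε₀ hκ
  set g : Euc N → ℝ := fun x => θ x + (u x₀ - φ x₀ + ε) with hg
  have hgu : ∀ y, ε < torusBump x₀ y → g y < u y := fun y hy => by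
    simp only [g, θ]; linarith [hmin y]
  have hgc : Continuous g := hθ1.continuous.add continuous_const
  have hglip : ∀ x ∈ U, ∀ M, 0 ≤ M → a ≤ σ x * m M →
      LipAt (fun y => g y + inner ℝ P y) x (M - δ) := fun x hx M hM haM ε hε => by
    filter_upwards [hUlip x hx M hM haM ε hε] with y hy
    convert hy using 2
    simp only [g]; ring
  have hx₀ : u x₀ < g x₀ := by simp only [g, θ, torusBump_self]; linarith
  refine ⟨fun x => max (u x) (g x), ⟨fun x z => ?_, fun x M hM haM => ?_⟩, lt_max_of_lt_right hx₀,
    fun y hy => max_eq_left (hgu y ((min_le_right _ _).trans_lt hy)).le, δ, hδpos, ?_⟩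
  · simp only [g]; rw [hu.periodic x z, hθp x z]
  · have hux := hu.lipAt x M hM haM
    by_cases hb : ε < torusBump x₀ x
    · refine hux.congr ?_
      filter_upwards [hgc.continuousAt.eventually_lt huc.continuousAt (hgu x hb)] with y hy
      rw [max_eq_left hy.le]
    · have hxU : x ∈ U := hε₀U x ((not_lt.1 hb).trans (min_le_left _ _))
      have hgx := (hglip x hxU M hM haM).mono (by linarith : M - δ ≤ M)
      simpa only [max_add_add_right] using hux.max hgx
  · have hev := huc.continuousAt.eventually_lt hgc.continuousAt hx₀
    filter_upwards [hUo.mem_nhds hδ, hev.eventually_nhds] with x hxU hx M hM haM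
    refine (hglip x hxU M hM haM).congr ?_
    filter_upwards [hx] with y hy
    rw [max_eq_right hy.le]

/-- Either some maximal metric subsolution solves the cell problem at level `a`, or there is a
metric subsolution with a uniform margin. -/
lemma IsMetricSub.exists_solution_or_strict (hu : IsMetricSub σ m P a u) {R : ℝ} (hR : 0 ≤ R)
    (haR : ∀ x, a ≤ σ x * m R) (hσ : Continuous σ) (hσp : IsZPeriodic σ) (hσpos : ∀ x, 0 < σ x)
    (hmc : ContinuousOn m (Ici 0)) (hm : StrictMonoOn m (Ici 0)) (ha : ∀ x, σ x * m 0 ≤ a) :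
    (∃ y, IsCellSolution (fun x p => σ x * m ‖p‖) P (maxSub σ m P a y) a) ∨
      ∃ v, IsMetricSub σ m P a v ∧ ∃ δ > 0, ∀ x, IsStrictAt σ m P a δ v x := by
  refine or_iff_not_imp_left.2 fun hno => ?_
  push Not at hno
  have hloc : ∀ y, ∃ v, IsMetricSub σ m P a v ∧ ∃ δ > 0, ∀ᶠ x in 𝓝 y,
      IsStrictAt σ m P a δ v x := fun y => by
    have hS := hu.isMetricSub_maxSub hR haR hσ hσpos hm y
    have hSl := hS.lipschitzWith hR haR
    have hsup : ¬ IsCellSupersolution (fun x p => σ x * m ‖p‖) P a (maxSub σ m P a y) :=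
      fun h => hno y ⟨⟨_, hSl⟩, hS.periodic, hS.isCellSubsolution hmc ha, h⟩
    simp only [IsCellSupersolution] at hsup
    push Not at hsup
    obtain ⟨x₀, q, ⟨φ, hφ, hφp, hmin, rfl⟩, hlt⟩ := hsup
    have hzero : torusBump x₀ y = 0 := by
      by_contra hne
      have hpos := (torusBump_nonneg x₀ y).lt_of_ne' hne
      obtain ⟨v, hv, hvx, hvy, -⟩ := hS.exists_bump hSl.continuous hσ hσp hσpos hmc hm hφ hφp hmin
        hlt (half_pos hpos)
      have h1 := hv.sub_le_maxSub hR haR x₀ y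
      rw [hvy y (half_lt_self hpos), maxSub_self] at h1
      linarith
    obtain ⟨z, rfl⟩ := exists_of_torusBump_eq_zero hzero
    obtain ⟨v, hv, -, -, δ, hδ, hst⟩ := hS.exists_bump hSl.continuous hσ hσp hσpos hmc hm hφ hφp
      hmin hlt one_pos
    refine ⟨v, hv, δ, hδ, ?_⟩
    have ht : Tendsto (fun x => x + intVec (-z)) (𝓝 (x₀ + intVec z)) (𝓝 x₀) := by
      have : Continuous fun x : Euc N => x + intVec (-z) := by fun_prop
      simpa [intVec_neg] using this.tendsto (x₀ + intVec z)
    exact (ht.eventually hst).mono fun x hx => hx.of_add_intVec hσp hv.periodic _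
  obtain ⟨K, hK, hKz⟩ := exists_isCompact_fundamental N
  obtain ⟨v, hv, δ, hδ, hst⟩ : ∃ v, IsMetricSub σ m P a v ∧ ∃ δ > 0, ∀ x ∈ K,
      IsStrictAt σ m P a δ v x := by
    refine hK.induction_on (p := fun s => ∃ v, IsMetricSub σ m P a v ∧ ∃ δ > 0, ∀ x ∈ s,
      IsStrictAt σ m P a δ v x) ⟨u, hu, 1, one_pos, by simp⟩ ?_ ?_ ?_
    · rintro s t hst ⟨v, hv, δ, hδ, h⟩
      exact ⟨v, hv, δ, hδ, fun x hx => h x (hst hx)⟩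
    · rintro s t ⟨v, hv, δ, hδ, h⟩ ⟨v', hv', δ', hδ', h'⟩
      refine ⟨_, hv.average hv', min δ δ' / 2, half_pos (lt_min hδ hδ'), ?_⟩
      rintro x (hx | hx)
      · exact ((h x hx).mono (min_le_left _ _)).average hv'
      · simpa only [add_comm] using ((h' x hx).mono (min_le_right _ _)).average hv
    · intro y _
      obtain ⟨v, hv, δ, hδ, h⟩ := hloc y
      exact ⟨_, mem_nhdsWithin_of_mem_nhds h, v, hv, δ, hδ, fun x hx => hx⟩
  refine ⟨v, hv, δ, hδ, fun x => ?_⟩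
  obtain ⟨z, hz⟩ := hKz x
  exact (hst _ hz).of_add_intVec hσp hv.periodic z

/-- A metric subsolution with a uniform margin is a metric subsolution at some lower level. -/
lemma exists_isMetricSub_lt {σmin R δ : ℝ} (hper : IsZPeriodic u) (hR : 0 ≤ R) (hδ : 0 < δ)
    (haR : ∀ x, a ≤ σ x * m R) (hσmin : 0 < σmin) (hσ : ∀ x, σmin ≤ σ x)
    (hmc : ContinuousOn m (Ici 0)) (hm : StrictMonoOn m (Ici 0))
    (hu : ∀ x, IsStrictAt σ m P a δ u x) :
    ∃ η > 0, IsMetricSub σ m P (a - η) u := by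
  obtain ⟨M₀, hM₀, hmin⟩ := (isCompact_Icc (a := 0) (b := R)).exists_isMinOn
    ⟨0, left_mem_Icc.2 hR⟩ (f := fun M => m (M + δ) - m M)
    ((hmc.comp (by fun_prop) fun M hM => mem_Ici.2 (by linarith [hM.1])).sub
      (hmc.mono fun M hM => hM.1))
  have hpos : 0 < m (M₀ + δ) - m M₀ :=
    sub_pos.2 (hm hM₀.1 (mem_Ici.2 (by linarith [hM₀.1])) (by linarith))
  refine ⟨σmin * (m (M₀ + δ) - m M₀), mul_pos hσmin hpos, hper, fun x M hM h => ?_⟩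
  have hMδ : 0 ≤ M + δ := by positivity
  suffices a ≤ σ x * m (M + δ) by simpa using hu x (M + δ) hMδ this
  have hσx : 0 < σ x := hσmin.trans_le (hσ x)
  rcases le_total M R with hMR | hMR
  · have h1 : m (M₀ + δ) - m M₀ ≤ m (M + δ) - m M := hmin ⟨hM, hMR⟩
    have h2 := mul_le_mul (hσ x) h1 hpos.le hσx.le
    rw [mul_sub (σ x)] at h2
    linarith
  · refine (haR x).trans (mul_le_mul_of_nonneg_left ?_ hσx.le)
    exact hm.monotoneOn hR hMδ (by linarith)

/-- The infimum of the levels admitting a metric subsolution is attained. -/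
lemma exists_isLeast_level {b c R : ℝ} (hu : IsMetricSub σ m P b u) (hcb : c ≤ b) (hR : 0 ≤ R)
    (hbR : ∀ x, b ≤ σ x * m R) (hσ : Continuous σ) (hσpos : ∀ x, 0 < σ x)
    (hm : StrictMonoOn m (Ici 0)) :
    ∃ a, IsLeast {a | c ≤ a ∧ a ≤ b ∧ ∃ v, IsMetricSub σ m P a v} a := by
  set A := {a | c ≤ a ∧ a ≤ b ∧ ∃ v, IsMetricSub σ m P a v}
  have hbA : b ∈ A := ⟨hcb, le_rfl, u, hu⟩
  have hAb : BddBelow A := ⟨c, fun a ha => ha.1⟩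
  have : Nonempty A := ⟨⟨b, hbA⟩⟩
  set B : Set (Euc N → ℝ) :=
    Set.pi univ fun x => Icc (-((R + ‖P‖) * ‖x‖)) ((R + ‖P‖) * ‖x‖)
  have hBc : IsCompact B := isCompact_univ_pi fun _ => isCompact_Icc
  have hBcl : IsClosed B := isClosed_set_pi fun _ _ => isClosed_Icc
  have hdir : Directed (· ⊇ ·) fun a : A => B ∩ {v | IsMetricSub σ m P a.1 v} := by
    intro a a'
    rcases le_total a.1 a'.1 with h | h
    · exact ⟨a, subset_rfl, fun v hv => ⟨hv.1, hv.2.mono h⟩⟩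
    · exact ⟨a', fun v hv => ⟨hv.1, hv.2.mono h⟩, subset_rfl⟩
  have hne : ∀ a : A, (B ∩ {v | IsMetricSub σ m P a.1 v}).Nonempty := by
    rintro ⟨a, -, hab, v, hv⟩
    refine ⟨fun x => v x - v 0, fun x _ => ?_, hv.sub_const _⟩
    have haR := fun x => hab.trans (hbR x)
    have h1 := hv.sub_le hR haR 0 x
    have h2 := hv.sub_le hR haR x 0
    rw [sub_zero] at h1
    rw [zero_sub, norm_neg] at h2
    exact ⟨by linarith, h1⟩
  obtain ⟨v, hv⟩ := IsCompact.nonempty_iInter_of_directed_nonempty_isCompact_isClosed _ hdir hne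
    (fun a => hBc.inter_right (isClosed_setOf_isMetricSub hσ hσpos hm))
    (fun a => hBcl.inter (isClosed_setOf_isMetricSub hσ hσpos hm))
  rw [mem_iInter] at hv
  have hinf := isGLB_csInf ⟨b, hbA⟩ hAb
  refine ⟨sInf A, ⟨le_csInf ⟨b, hbA⟩ fun a ha => ha.1, csInf_le hAb hbA, v,
    (hv ⟨b, hbA⟩).2.periodic, fun x M hM h => LipAt.of_forall_gt fun M' hM' => ?_⟩, hinf.1⟩
  have hlt : sInf A < σ x * m M' := h.trans_lt
    (mul_lt_mul_of_pos_left (hm hM (hM.trans hM'.le) hM') (hσpos x))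
  obtain ⟨a, haA, ha⟩ := exists_lt_of_csInf_lt ⟨b, hbA⟩ hlt
  exact (hv ⟨a, haA⟩).2.lipAt x M' (hM.trans hM'.le) ha.le

end Perron

/-- A sufficient condition for solvability of the cell problem:
if `σ̄ m₀ < σ̲` and there is a periodic `ψ ∈ C¹` with `Dψ = −P` on
`{σ ≠ σ̲}`, then `P` belongs to the solvability set. -/
theorem sufficient_condition_solvability {N : ℕ} (hN : 1 ≤ N)
    (σ : Euc N → ℝ) (m : ℝ → ℝ) (L : NNReal)
    (hσc : Continuous σ) (hσp : IsZPeriodic σ) (hσpos : ∀ x, 0 < σ x)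
    (hm01 : ∀ r : ℝ, 0 ≤ r → 0 < m r ∧ m r < 1)
    (hmLip : LipschitzOnWith L m (Set.Ici 0))
    (hmmono : StrictMonoOn m (Set.Ici 0))
    (hmlim : Tendsto m atTop (nhds 1))
    (σmax σmin : ℝ)
    (hσmax : IsGreatest (Set.range σ) σmax) (hσmin : IsLeast (Set.range σ) σmin)
    (hcond : σmax * m 0 < σmin)
    (P : Euc N) (ψ : Euc N → ℝ)
    (hψC1 : ContDiff ℝ 1 ψ) (hψper : IsZPeriodic ψ)
    (hψgrad : ∀ x : Euc N, σ x ≠ σmin → gradient ψ x = -P) :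
    ∃ (u : Euc N → ℝ) (a : ℝ),
      IsCellSolution (fun x p => σ x * m ‖p‖) P u a := by
  have hmc := hmLip.continuousOn
  have hm0 : 0 < m 0 := (hm01 0 le_rfl).1
  have hle_max : ∀ x, σ x * m 0 ≤ σmax * m 0 := fun x =>
    mul_le_mul_of_nonneg_right (hσmax.2 ⟨x, rfl⟩) hm0.le
  have hmin_le : ∀ x, σmin ≤ σ x := fun x => hσmin.2 ⟨x, rfl⟩
  have hσmin0 : 0 < σmin := by obtain ⟨x, rfl⟩ := hσmin.1; exact hσpos x
  have hψlt : ∀ x, σ x * m ‖gradient ψ x + P‖ < σmin := fun x => by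
    by_cases hx : σ x = σmin
    · rw [hx]
      exact mul_lt_of_lt_one_right hσmin0 (hm01 _ (norm_nonneg _)).2
    · rw [hψgrad x hx, neg_add_cancel, norm_zero]
      exact (hle_max x).trans_lt hcond
  have hHc : Continuous fun x => σ x * m ‖gradient ψ x + P‖ :=
    hσc.mul (hmc.comp_continuous (hψC1.continuous_gradient.add continuous_const).norm
      fun x => norm_nonneg _)
  obtain ⟨b, hb, hψb⟩ : ∃ b < σmin, ∀ x, σ x * m ‖gradient ψ x + P‖ ≤ b := by
    obtain ⟨K, hK, hKz⟩ := exists_isCompact_fundamental N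
    obtain ⟨x₁, -, hx₁⟩ := hK.exists_isMaxOn ((hKz 0).imp' (fun z => 0 + intVec z) fun _ h => h)
      hHc.continuousOn
    refine ⟨_, hψlt x₁, fun x => ?_⟩
    obtain ⟨z, hz⟩ := hKz x
    have h1 := isMaxOn_iff.1 hx₁ _ hz
    rwa [hσp x z, hψper.gradient_add x z] at h1
  obtain ⟨xM, hxM⟩ := hσmax.1
  have hmb : σmax * m 0 ≤ b := by
    rw [← hxM]
    refine le_trans (mul_le_mul_of_nonneg_left ?_ (hσpos xM).le) (hψb xM)
    exact hmmono.monotoneOn (mem_Ici.2 le_rfl) (norm_nonneg _) (norm_nonneg _)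
  have hψsub : IsMetricSub σ m P b ψ := by
    refine ⟨hψper, fun x M hM h => (lipAt_of_contDiff hψC1 x).mono ?_⟩
    exact (hmmono.le_iff_le (norm_nonneg _) hM).1
      (le_of_mul_le_mul_left ((hψb x).trans h) (hσpos x))
  obtain ⟨R, hbR, hR⟩ : ∃ R, (∀ x, b ≤ σ x * m R) ∧ 0 ≤ R := by
    obtain ⟨R, h1, h2⟩ := ((hmlim.eventually (lt_mem_nhds ((div_lt_one hσmin0).2 hb))).and
      (eventually_ge_atTop 0)).exists
    rw [div_lt_iff₀' hσmin0] at h1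
    exact ⟨R, fun x => h1.le.trans
      (mul_le_mul_of_nonneg_right (hmin_le x) (hm01 R h2).1.le), h2⟩
  obtain ⟨a, ⟨hca, hab, v, hv⟩, hleast⟩ :=
    exists_isLeast_level hψsub hmb hR hbR hσc hσpos hmmono
  have haR : ∀ x, a ≤ σ x * m R := fun x => hab.trans (hbR x)
  rcases hv.exists_solution_or_strict hR haR hσc hσp hσpos hmc hmmono
    (fun x => (hle_max x).trans hca) with ⟨y, hy⟩ | ⟨w, hw, δ, hδ, hst⟩
  · exact ⟨_, a, hy⟩
  have hlt : σmax * m 0 < a := by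
    refine hca.lt_of_ne fun h => ?_
    have : Nonempty (Fin N) := ⟨⟨0, hN⟩⟩
    have := (hst xM 0 le_rfl (by rw [hxM, h])).nonneg
    linarith
  obtain ⟨η, hη, hwη⟩ := exists_isMetricSub_lt hw.periodic hR hδ haR hσmin0 hmin_le hmc hmmono hst
  have hmem := hleast ⟨le_max_left (σmax * m 0) (a - η), max_le hmb (by linarith), w,
    hwη.mono (le_max_right _ _)⟩
  rcases le_max_iff.1 hmem with h | h <;> linarith
end
end

section
/- One-dimensional solvability set: Let N = 1 and assume σ̄ m₀ < σ̲. If ∫₀¹ f_σ̲(z) dz < ∞, then D = (−∫₀¹ f_σ̲(z) dz, ∫₀¹ f_σ̲(z) dz); if ∫₀¹ f_σ̲(z) dz = ∞, then D = ℝ. -/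
open Set Filter MeasureTheory

noncomputable section

def IsZPeriodic1 (u : ℝ → ℝ) : Prop :=
  ∀ (x : ℝ) (z : ℤ), u (x + z) = u x

def superDiff1 (u : ℝ → ℝ) (x : ℝ) : Set ℝ :=
  { q | ∃ φ : ℝ → ℝ, ContDiff ℝ 1 φ ∧ IsZPeriodic1 φ ∧
        (∀ y, u y - φ y ≤ u x - φ x) ∧ q = deriv φ x }

def subDiff1 (u : ℝ → ℝ) (x : ℝ) : Set ℝ :=
  { q | ∃ φ : ℝ → ℝ, ContDiff ℝ 1 φ ∧ IsZPeriodic1 φ ∧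
        (∀ y, u x - φ x ≤ u y - φ y) ∧ q = deriv φ x }

def IsCellSubsolution1 (H : ℝ → ℝ → ℝ) (P : ℝ) (a : ℝ) (u : ℝ → ℝ) : Prop :=
  ∀ x, ∀ q ∈ superDiff1 u x, H x (q + P) ≤ a

def IsCellSupersolution1 (H : ℝ → ℝ → ℝ) (P : ℝ) (a : ℝ) (u : ℝ → ℝ) : Prop :=
  ∀ x, ∀ q ∈ subDiff1 u x, a ≤ H x (q + P)

def IsCellSolution1 (H : ℝ → ℝ → ℝ) (P : ℝ) (u : ℝ → ℝ) (a : ℝ) : Prop :=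
  (∃ K : NNReal, LipschitzWith K u) ∧ IsZPeriodic1 u ∧
    IsCellSubsolution1 H P a u ∧ IsCellSupersolution1 H P a u

lemma nonneg_of_eventually_right {D : ℝ → ℝ} {d x : ℝ} (hD : HasDerivAt D d x)
    (h : ∀ᶠ y in nhdsWithin x (Ioi x), D x ≤ D y) : 0 ≤ d := by
  have h1 : Tendsto (slope D x) (nhdsWithin x (Ioi x)) (nhds d) :=
    (hasDerivAt_iff_tendsto_slope.1 hD).mono_left
      (nhdsWithin_mono _ fun y hy => (ne_of_gt hy : y ≠ x))
  refine ge_of_tendsto h1 ?_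
  filter_upwards [h, self_mem_nhdsWithin] with y hy hxy
  rw [slope_def_field]
  exact div_nonneg (sub_nonneg.2 hy) (sub_nonneg.2 (le_of_lt hxy))

lemma nonneg_of_eventually_left {D : ℝ → ℝ} {d x : ℝ} (hD : HasDerivAt D d x)
    (h : ∀ᶠ y in nhdsWithin x (Iio x), D y ≤ D x) : 0 ≤ d := by
  have h1 : Tendsto (slope D x) (nhdsWithin x (Iio x)) (nhds d) :=
    (hasDerivAt_iff_tendsto_slope.1 hD).mono_left
      (nhdsWithin_mono _ fun y hy => (ne_of_lt hy : y ≠ x))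
  refine ge_of_tendsto h1 ?_
  filter_upwards [h, self_mem_nhdsWithin] with y hy hxy
  rw [slope_def_field]
  exact div_nonneg_of_nonpos (sub_nonpos.2 hy) (sub_nonpos.2 (le_of_lt hxy))

lemma IsZPeriodic1.of_periodic {u : ℝ → ℝ} (h : Function.Periodic u 1) : IsZPeriodic1 u := by
  intro x z
  simpa using h.int_mul z x

lemma IsZPeriodic1.periodic {u : ℝ → ℝ} (h : IsZPeriodic1 u) : Function.Periodic u 1 := by
  intro x
  simpa using h x 1

lemma IsZPeriodic1.exists_forall_le {u : ℝ → ℝ} (hp : IsZPeriodic1 u) (hc : Continuous u)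
    (s : ℝ) : ∃ x ∈ Icc s (s + 1), ∀ y, u y ≤ u x := by
  obtain ⟨x, hx, hmax⟩ := (isCompact_Icc (a := s) (b := s + 1)).exists_isMaxOn
    ⟨s, by simp⟩ hc.continuousOn
  refine ⟨x, hx, fun y => ?_⟩
  obtain ⟨z, hz, hyz⟩ := hp.periodic.exists_mem_Ico one_pos y s
  rw [hyz]
  exact hmax (Ico_subset_Icc_self hz)

lemma exists_rightInverse {m : ℝ → ℝ} (hmc : ContinuousOn m (Ici 0))
    (hmlim : Tendsto m atTop (nhds 1)) :
    ∃ N : ℝ → ℝ, ∀ b ∈ Ico (m 0) 1, 0 ≤ N b ∧ m (N b) = b := by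
  have h : ∀ b, ∃ r, b ∈ Ico (m 0) 1 → 0 ≤ r ∧ m r = b := by
    intro b
    by_cases hb : b ∈ Ico (m 0) 1
    · obtain ⟨R, hR, hR0⟩ :=
        ((hmlim.eventually_const_lt hb.2).and (eventually_ge_atTop 0)).exists
      obtain ⟨r, hr, hrb⟩ := intermediate_value_Icc hR0
        (hmc.mono Icc_subset_Ici_self) ⟨hb.1, hR.le⟩
      exact ⟨r, fun _ => ⟨hr.1, hrb⟩⟩
    · exact ⟨0, fun h => absurd h hb⟩
  choose N hN using h
  exact ⟨N, hN⟩

lemma continuous_of_strictMonoOn_comp {X : Type*} [TopologicalSpace X] {m : ℝ → ℝ}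
    (hm : StrictMonoOn m (Ici 0)) {F g : X → ℝ} (hg : Continuous g) (hF : ∀ x, 0 ≤ F x)
    (hFg : ∀ x, m (F x) = g x) : Continuous F := by
  rw [continuous_iff_lower_upperSemicontinuous]
  constructor
  · intro x r hr
    rcases lt_or_ge r 0 with h0 | h0
    · exact Eventually.of_forall fun y => h0.trans_le (hF y)
    · have h1 : m r < g x := hFg x ▸ hm h0 (hF x) hr
      filter_upwards [hg.continuousAt.eventually (lt_mem_nhds h1)] with y hy
      rw [← hFg y] at hy
      exact (hm.lt_iff_lt h0 (hF y)).1 hy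
  · intro x r hr
    have h0 : 0 ≤ r := (hF x).trans hr.le
    have h1 : g x < m r := hFg x ▸ hm (hF x) h0 hr
    filter_upwards [hg.continuousAt.eventually (gt_mem_nhds h1)] with y hy
    rw [← hFg y] at hy
    exact (hm.lt_iff_lt (hF y) h0).1 hy

lemma isCellSolution1_of_profile {σ m F w Φ : ℝ → ℝ} {P a M : ℝ}
    (hm : MonotoneOn m (Ici 0)) (hσpos : ∀ x, 0 < σ x) (hF0 : ∀ x, 0 ≤ F x)
    (hFa : ∀ x, σ x * m (F x) = a) (hFM : ∀ x, F x ≤ M)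
    (hΦ : ∀ x, HasDerivAt Φ (F x) x)
    (hw : ∀ x y, x ≤ y → |w y - w x| ≤ Φ y - Φ x)
    (hper : ∀ x, w (x + 1) = w x + P)
    (hsgn : ∀ x, F x = 0 ∨
      (∀ᶠ y in nhdsWithin x (Ioi x), w y - w x = -(Φ y - Φ x)) ∨
      (∀ᶠ y in nhdsWithin x (Iio x), w x - w y = Φ x - Φ y)) :
    IsCellSolution1 (fun x p => σ x * m |p|) P (fun x => w x - P * x) a := by
  have hM0 : 0 ≤ M := (hF0 0).trans (hFM 0)
  have hΦL : ∀ x y, x ≤ y → Φ y - Φ x ≤ M * (y - x) := by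
    intro x y hxy
    have hd : Differentiable ℝ Φ := fun z => (hΦ z).differentiableAt
    exact image_sub_le_mul_sub_of_deriv_le hd (fun z => (hΦ z).deriv ▸ hFM z) hxy
  have hwL : ∀ x y, |w x - w y| ≤ M * |x - y| := by
    intro x y
    rcases le_total x y with h | h
    · rw [abs_sub_comm, abs_sub_comm x y, abs_of_nonneg (sub_nonneg.2 h)]
      exact (hw x y h).trans (hΦL x y h)
    · rw [abs_of_nonneg (sub_nonneg.2 h)]
      exact (hw y x h).trans (hΦL y x h)
  have hphi : ∀ φ : ℝ → ℝ, ContDiff ℝ 1 φ → ∀ x,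
      HasDerivAt (fun y => φ y + P * y) (deriv φ x + P) x := by
    intro φ hφ x
    have h1 := (hφ.differentiable one_ne_zero x).hasDerivAt
    have h2 : HasDerivAt (fun y => P * y) P x := by simpa using (hasDerivAt_id x).const_mul P
    exact h1.add h2
  refine ⟨⟨(M + |P|).toNNReal, ?_⟩, ?_, ?_, ?_⟩
  · refine LipschitzWith.of_dist_le_mul fun x y => ?_
    rw [Real.coe_toNNReal _ (by positivity), Real.dist_eq, Real.dist_eq]
    calc |w x - P * x - (w y - P * y)| = |(w x - w y) - P * (x - y)| := by ring_nf
      _ ≤ |w x - w y| + |P * (x - y)| := abs_sub _ _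
      _ ≤ M * |x - y| + |P| * |x - y| := by rw [abs_mul]; gcongr; exact hwL x y
      _ = (M + |P|) * |x - y| := by ring
  · refine IsZPeriodic1.of_periodic fun x => ?_
    simp only [hper]
    ring
  · rintro x _ ⟨φ, hφ, -, hmax, rfl⟩
    have hψ := hphi φ hφ x
    have h1 : 0 ≤ F x - (deriv φ x + P) := by
      refine nonneg_of_eventually_left ((hΦ x).sub hψ) ?_
      filter_upwards [self_mem_nhdsWithin] with y hy
      have h2 := (abs_le.1 (hw y x (le_of_lt hy))).2
      have h3 := hmax y
      simp only [Pi.sub_apply]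
      linarith
    have h2 : 0 ≤ F x + (deriv φ x + P) := by
      refine nonneg_of_eventually_right ((hΦ x).add hψ) ?_
      filter_upwards [self_mem_nhdsWithin] with y hy
      have h2 := (abs_le.1 (hw x y (le_of_lt hy))).1
      have h3 := hmax y
      simp only [Pi.add_apply]
      linarith
    have h3 : |deriv φ x + P| ≤ F x := abs_le.2 ⟨by linarith, by linarith⟩
    rw [← hFa x]
    exact mul_le_mul_of_nonneg_left (hm (mem_Ici.2 (abs_nonneg _)) (hF0 x) h3) (hσpos x).le
  · rintro x _ ⟨φ, hφ, -, hmin, rfl⟩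
    have hψ := hphi φ hφ x
    have key : F x ≤ |deriv φ x + P| := by
      rcases hsgn x with h | h | h
      · exact h ▸ abs_nonneg _
      · have h2 : 0 ≤ -F x - (deriv φ x + P) := by
          refine nonneg_of_eventually_right ((hΦ x).neg.sub hψ) ?_
          filter_upwards [h] with y hy
          have h3 := hmin y
          simp only [Pi.sub_apply, Pi.neg_apply]
          linarith
        exact le_trans (by linarith) (neg_le_abs _)
      · have h2 : 0 ≤ (deriv φ x + P) - F x := by
          refine nonneg_of_eventually_left (hψ.sub (hΦ x)) ?_
          filter_upwards [h] with y hy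
          have h3 := hmin y
          simp only [Pi.sub_apply]
          linarith
        exact le_trans (by linarith) (le_abs_self _)
    rw [← hFa x]
    exact mul_le_mul_of_nonneg_left (hm (hF0 x) (mem_Ici.2 (abs_nonneg _)) key) (hσpos x).le

lemma isCellSolution1_of_switch {σ m F : ℝ → ℝ} {P a x₀ c : ℝ}
    (hm : MonotoneOn m (Ici 0)) (hσpos : ∀ x, 0 < σ x) (hF0 : ∀ x, 0 ≤ F x)
    (hFa : ∀ x, σ x * m (F x) = a) (hFc : Continuous F) (hFp : IsZPeriodic1 F)
    (hc0 : 0 ≤ c) (hc1 : c ≤ 1) (hend : F x₀ = 0 ∨ c = 0 ∨ c = 1)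
    (hP : P = (∫ z in x₀..x₀ + c, F z) - ∫ z in x₀ + c..x₀ + 1, F z) :
    ∃ u, IsCellSolution1 (fun x p => σ x * m |p|) P u a := by
  obtain ⟨xM, -, hM⟩ := hFp.exists_forall_le hFc 0
  set h : ℝ → ℝ := fun y => if Int.fract (y - x₀) < c then F y else -F y with hh
  have hhm : Measurable h := by
    refine Measurable.ite ?_ hFc.measurable hFc.measurable.neg
    exact measurableSet_lt (measurable_fract.comp (measurable_id.sub_const x₀)) measurable_const
  have habs : ∀ y, |h y| = F y := by
    intro y
    simp only [hh]
    split_ifs <;> simp [abs_of_nonneg (hF0 y)]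
  have hhi : ∀ s t, IntervalIntegrable h volume s t := fun s t =>
    (hFc.intervalIntegrable s t).mono_fun hhm.aestronglyMeasurable
      (Eventually.of_forall fun y => by simp [habs, abs_of_nonneg (hF0 y)])
  have hFi : ∀ s t, IntervalIntegrable F volume s t := hFc.intervalIntegrable
  have hhp : Function.Periodic h 1 := by
    intro y
    simp only [hh, hFp.periodic y]
    rw [show y + 1 - x₀ = y - x₀ + 1 by ring, Int.fract_add_one]
  have hfr : ∀ y (n : ℤ), n ≤ y - x₀ → y - x₀ < n + 1 → Int.fract (y - x₀) = y - x₀ - n := by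
    intro y n h1 h2
    rw [← Int.self_sub_floor, Int.floor_eq_iff.2 ⟨h1, h2⟩]
  have hw : ∀ x y, (∫ z in 0..y, h z) - (∫ z in 0..x, h z) = ∫ z in x..y, h z := fun x y =>
    intervalIntegral.integral_interval_sub_left (hhi _ _) (hhi _ _)
  have hΦ : ∀ x y, (∫ z in 0..y, F z) - (∫ z in 0..x, F z) = ∫ z in x..y, F z := fun x y =>
    intervalIntegral.integral_interval_sub_left (hFi _ _) (hFi _ _)
  have hone : ∫ z in x₀..x₀ + 1, h z = P := by
    rw [← intervalIntegral.integral_add_adjacent_intervals (hhi x₀ (x₀ + c)) (hhi _ _), hP,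
      sub_eq_add_neg, ← intervalIntegral.integral_neg]
    have hne : ∀ s : ℝ, ∀ᵐ y : ℝ, y ≠ s := fun s => by simp [ae_iff]
    congr 1
    · refine intervalIntegral.integral_congr_ae ?_
      filter_upwards [hne (x₀ + c)] with y hy hmem
      rw [uIoc_of_le (by linarith)] at hmem
      have hlt := lt_of_le_of_ne hmem.2 hy
      simp only [hh]
      rw [if_pos]
      rw [hfr y 0 (by push_cast; linarith [hmem.1]) (by push_cast; linarith)]
      push_cast; linarith
    · refine intervalIntegral.integral_congr_ae ?_
      filter_upwards [hne (x₀ + 1)] with y hy hmem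
      rw [uIoc_of_le (by linarith)] at hmem
      have hlt := lt_of_le_of_ne hmem.2 hy
      simp only [hh]
      rw [if_neg]
      rw [hfr y 0 (by push_cast; linarith [hmem.1]) (by push_cast; linarith)]
      push_cast; linarith [hmem.1]
  refine ⟨_, isCellSolution1_of_profile (w := fun x => ∫ z in 0..x, h z)
    (Φ := fun x => ∫ z in 0..x, F z) hm hσpos hF0 hFa hM ?_ ?_ ?_ ?_⟩
  · intro x
    exact hFc.integral_hasStrictDerivAt 0 x |>.hasDerivAt
  · intro x y hxy
    simp only [hw, hΦ]
    refine (intervalIntegral.abs_integral_le_integral_abs hxy).trans (le_of_eq ?_)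
    simp only [habs]
  · intro x
    have h1 := hw x (x + 1)
    rw [hhp.intervalIntegral_add_eq x x₀, hone] at h1
    linarith
  · intro x
    simp only [hw, hΦ]
    set n := ⌊x - x₀⌋ with hn
    have hn1 : (n : ℝ) ≤ x - x₀ := Int.floor_le _
    have hn2 : x - x₀ < n + 1 := Int.lt_floor_add_one _
    rcases le_or_gt c (x - x₀ - n) with htc | htc
    · right; left
      filter_upwards [Ioo_mem_nhdsGT (show x < x₀ + n + 1 by linarith)] with y hy
      rw [← intervalIntegral.integral_neg]
      refine intervalIntegral.integral_congr fun z hz => ?_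
      rw [uIcc_of_le hy.1.le] at hz
      simp only [hh]
      rw [if_neg]
      rw [hfr z n (by linarith [hz.1]) (by linarith [hz.2, hy.2])]
      linarith [hz.1]
    rcases hn1.lt_or_eq with hpos | hzero
    · right; right
      filter_upwards [Ioo_mem_nhdsLT (show x₀ + n < x by linarith)] with y hy
      refine intervalIntegral.integral_congr fun z hz => ?_
      rw [uIcc_of_le hy.2.le] at hz
      simp only [hh]
      rw [if_pos]
      rw [hfr z n (by linarith [hz.1, hy.1]) (by linarith [hz.2])]
      linarith [hz.2]
    · rcases hend with hend | hend | hend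
      · left
        rw [show x = x₀ + n by linarith, hFp, hend]
      · linarith
      · right; right
        refine Eventually.of_forall fun y => ?_
        refine intervalIntegral.integral_congr fun z hz => ?_
        simp only [hh]
        rw [if_pos]
        rw [hend]
        exact Int.fract_lt_one _

lemma subDiff1_abs_le {u : ℝ → ℝ} {K : NNReal} (hu : LipschitzWith K u) {x q : ℝ}
    (hq : q ∈ subDiff1 u x) : |q| ≤ K := by
  obtain ⟨φ, hφ, -, hmin, rfl⟩ := hq
  have hd := (hφ.differentiable one_ne_zero x).hasDerivAt
  have hK : ∀ y, |u y - u x| ≤ K * |y - x| := fun y => by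
    simpa [Real.dist_eq] using hu.dist_le_mul y x
  have hlin : HasDerivAt (fun y => (K : ℝ) * y) K x := by
    simpa using (hasDerivAt_id x).const_mul (K : ℝ)
  have h1 : 0 ≤ (K : ℝ) - deriv φ x := by
    refine nonneg_of_eventually_right (hlin.sub hd) ?_
    filter_upwards [self_mem_nhdsWithin] with y hy
    have h2 := (abs_le.1 (hK y)).2
    rw [abs_of_nonneg (sub_nonneg.2 (le_of_lt hy))] at h2
    have h3 := hmin y
    simp only [Pi.sub_apply]
    linarith
  have h2 : 0 ≤ (K : ℝ) + deriv φ x := by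
    refine nonneg_of_eventually_left (hlin.add hd) ?_
    filter_upwards [self_mem_nhdsWithin] with y hy
    have h2 := (abs_le.1 (hK y)).2
    rw [abs_of_nonpos (sub_nonpos.2 (le_of_lt hy))] at h2
    have h3 := hmin y
    simp only [Pi.add_apply]
    linarith
  exact abs_le.2 ⟨by linarith, by linarith⟩

lemma exists_subDiff1_near {u : ℝ → ℝ} (hc : Continuous u) (hp : IsZPeriodic1 u) (x₀ : ℝ) :
    ∃ x : ℕ → ℝ, Tendsto x atTop (nhds x₀) ∧ ∀ n, (subDiff1 u (x n)).Nonempty := by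
  set φ : ℕ → ℝ → ℝ := fun n y => n * (Real.cos (2 * Real.pi * (y - x₀)) - 1) with hφ
  have hφc : ∀ n, ContDiff ℝ 1 (φ n) := fun n => by
    simp only [hφ]
    fun_prop
  have hφp : ∀ n, Function.Periodic (φ n) 1 := fun n y => by
    simp only [hφ]
    rw [show 2 * Real.pi * (y + 1 - x₀) = 2 * Real.pi * (y - x₀) + 2 * Real.pi by ring,
      Real.cos_add_two_pi]
  have hex : ∀ n, ∃ x ∈ Icc (x₀ - 1 / 2) (x₀ - 1 / 2 + 1), ∀ y, u x - φ n x ≤ u y - φ n y := by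
    intro n
    obtain ⟨x, hx, hmax⟩ := (IsZPeriodic1.of_periodic
      ((hφp n).sub hp.periodic)).exists_forall_le ((hφc n).continuous.sub hc) (x₀ - 1 / 2)
    refine ⟨x, hx, fun y => ?_⟩
    have := hmax y
    simp only [Pi.sub_apply] at this
    linarith
  choose x hxI hx using hex
  obtain ⟨yM, -, hyM⟩ := hp.exists_forall_le hc 0
  obtain ⟨ym, -, hym⟩ := (IsZPeriodic1.of_periodic (u := fun y => -u y)
    fun y => by simp [hp.periodic y]).exists_forall_le hc.neg 0
  set C := u yM - u ym with hC
  have hbd : ∀ n : ℕ, (n : ℝ) * (8 * (x n - x₀) ^ 2) ≤ C := by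
    intro n
    have h1 := hx n x₀
    have h2 := hyM x₀
    have h3 := hym (x n)
    have h4 : Real.cos (2 * Real.pi * (x n - x₀)) ≤ 1 - 8 * (x n - x₀) ^ 2 := by
      have habs : |2 * Real.pi * (x n - x₀)| ≤ Real.pi := by
        rw [abs_mul, abs_of_pos (by positivity)]
        have : |x n - x₀| ≤ 1 / 2 := abs_le.2 ⟨by linarith [(hxI n).1], by linarith [(hxI n).2]⟩
        nlinarith [Real.pi_pos]
      refine (Real.cos_le_one_sub_mul_cos_sq habs).trans (le_of_eq ?_)
      field_simp
      ring
    have h5 := mul_le_mul_of_nonneg_left h4 (Nat.cast_nonneg (α := ℝ) n)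
    simp only [hφ, sub_self, mul_zero, Real.cos_zero] at h1
    linarith
  refine ⟨x, ?_, fun n => ⟨_, φ n, hφc n, IsZPeriodic1.of_periodic (hφp n), hx n, rfl⟩⟩
  have hsq : Tendsto (fun n => (x n - x₀) ^ 2) atTop (nhds 0) := by
    refine squeeze_zero' (g := fun n : ℕ => C / n) (Eventually.of_forall fun n => sq_nonneg _) ?_
      (tendsto_const_div_atTop_nhds_zero_nat C)
    filter_upwards [eventually_gt_atTop 0] with n hn
    have hn' : (0 : ℝ) < n := Nat.cast_pos.2 hn
    rw [le_div_iff₀ hn']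
    nlinarith [hbd n, mul_nonneg hn'.le (sq_nonneg (x n - x₀))]
  have habs : Tendsto (fun n => |x n - x₀|) atTop (nhds 0) := by
    have := hsq.sqrt
    simpa [Real.sqrt_sq_eq_abs] using this
  rw [tendsto_iff_dist_tendsto_zero]
  simpa [Real.dist_eq] using habs

lemma IsCellSolution1.critical_lt {σ m u : ℝ → ℝ} {P a : ℝ}
    (h : IsCellSolution1 (fun x p => σ x * m |p|) P u a) (hσc : Continuous σ)
    (hσpos : ∀ x, 0 < σ x) (hm : MonotoneOn m (Ici 0)) (hm1 : ∀ r, 0 ≤ r → m r < 1) (x₀ : ℝ) :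
    a < σ x₀ := by
  obtain ⟨⟨K, hK⟩, hp, -, hsup⟩ := h
  obtain ⟨x, hx, hne⟩ := exists_subDiff1_near hK.continuous hp x₀
  have hR : (0 : ℝ) ≤ K + |P| := by positivity
  have hle : ∀ n, a ≤ σ (x n) * m (K + |P|) := by
    intro n
    obtain ⟨q, hq⟩ := hne n
    refine (hsup (x n) q hq).trans (mul_le_mul_of_nonneg_left ?_ (hσpos _).le)
    refine hm (mem_Ici.2 (abs_nonneg _)) hR ((abs_add_le _ _).trans ?_)
    gcongr
    exact subDiff1_abs_le hK hq
  have hlim : Tendsto (fun n => σ (x n) * m (K + |P|)) atTop (nhds (σ x₀ * m (K + |P|))) :=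
    ((hσc.tendsto x₀).comp hx).mul_const _
  calc a ≤ σ x₀ * m (K + |P|) := ge_of_tendsto' hlim hle
    _ < σ x₀ := mul_lt_of_lt_one_right (hσpos _) (hm1 _ hR)

lemma IsCellSolution1.abs_lt_integral {σ m u F : ℝ → ℝ} {P a b : ℝ}
    (h : IsCellSolution1 (fun x p => σ x * m |p|) P u a)
    (hσpos : ∀ x, 0 < σ x) (hm : MonotoneOn m (Ici 0)) (hab : a < b)
    (hF0 : ∀ x, 0 ≤ F x) (hFb : ∀ x, σ x * m (F x) = b) (hFc : Continuous F)
    (hFp : IsZPeriodic1 F) : |P| < ∫ z in 0..1, F z := by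
  obtain ⟨⟨K, hK⟩, hp, hsub, -⟩ := h
  set I := ∫ z in 0..1, F z with hI
  have key : ∀ x q, q ∈ superDiff1 u x → |q + P| < F x := by
    intro x q hq
    by_contra! hcon
    have h1 : σ x * m |q + P| ≤ a := hsub x q hq
    have h2 : b ≤ σ x * m |q + P| := by
      rw [← hFb x]
      exact mul_le_mul_of_nonneg_left (hm (hF0 x) (mem_Ici.2 (abs_nonneg _)) hcon) (hσpos x).le
    linarith
  set ψ : ℝ → ℝ := fun x => (∫ z in 0..x, F z) - I * x with hψ
  have hψd : ∀ x, HasDerivAt ψ (F x - I) x := fun x => by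
    have h1 : HasDerivAt (fun y => I * y) I x := by simpa using (hasDerivAt_id x).const_mul I
    exact (hFc.integral_hasStrictDerivAt 0 x).hasDerivAt.sub h1
  have hψ' : deriv ψ = fun x => F x - I := funext fun x => (hψd x).deriv
  have hψc : ContDiff ℝ 1 ψ := by
    rw [contDiff_one_iff_deriv, hψ']
    exact ⟨fun x => (hψd x).differentiableAt, by fun_prop⟩
  have hψp : Function.Periodic ψ 1 := fun x => by
    have h1 := intervalIntegral.integral_add_adjacent_intervals
      (hFc.intervalIntegrable (μ := volume) 0 x) (hFc.intervalIntegrable x (x + 1))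
    rw [hFp.periodic.intervalIntegral_add_eq x 0, zero_add] at h1
    simp only [hψ]
    linarith
  refine abs_lt.2 ⟨?_, ?_⟩
  · obtain ⟨x, -, hx⟩ := (IsZPeriodic1.of_periodic
      (hp.periodic.add hψp)).exists_forall_le (hK.continuous.add hψc.continuous) 0
    have hq : -(F x - I) ∈ superDiff1 u x := by
      refine ⟨-ψ, hψc.neg, IsZPeriodic1.of_periodic fun y => by simp [hψp y], fun y => ?_, ?_⟩
      · have := hx y
        simp only [Pi.add_apply] at this
        simp only [Pi.neg_apply]
        linarith
      · rw [deriv.neg, (hψd x).deriv]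
    have := (abs_lt.1 (key x _ hq)).1
    linarith
  · obtain ⟨x, -, hx⟩ := (IsZPeriodic1.of_periodic
      (hp.periodic.sub hψp)).exists_forall_le (hK.continuous.sub hψc.continuous) 0
    have hq : F x - I ∈ superDiff1 u x :=
      ⟨ψ, hψc, IsZPeriodic1.of_periodic hψp, hx, (hψd x).deriv.symm⟩
    have := (abs_lt.1 (key x _ hq)).2
    linarith

/-- `G a` is the profile `x ↦ m⁻¹ (a / σ x)` for every level `a` in `[a₀, b)`. -/
def IsProfileFamily (σ m : ℝ → ℝ) (a₀ b : ℝ) (G : ℝ → ℝ → ℝ) : Prop :=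
  ∀ a ∈ Ico a₀ b, ∀ x, 0 ≤ G a x ∧ σ x * m (G a x) = a

lemma exists_isProfileFamily {σ m : ℝ → ℝ} {σmax σmin : ℝ} (hσp : IsZPeriodic1 σ)
    (hσpos : ∀ x, 0 < σ x) (hmax : ∀ x, σ x ≤ σmax) (hmin : ∀ x, σmin ≤ σ x)
    (hm0 : 0 ≤ m 0) (hmc : ContinuousOn m (Ici 0)) (hmlim : Tendsto m atTop (nhds 1)) :
    ∃ G, IsProfileFamily σ m (σmax * m 0) σmin G ∧ ∀ a, IsZPeriodic1 (G a) := by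
  obtain ⟨N, hN⟩ := exists_rightInverse hmc hmlim
  refine ⟨fun a x => N (a / σ x), fun a ha x => ?_, fun a x z => by simp only [hσp x z]⟩
  have hmem : a / σ x ∈ Ico (m 0) 1 := by
    refine ⟨(le_div_iff₀ (hσpos x)).2 ?_, (div_lt_one (hσpos x)).2 (ha.2.trans_le (hmin x))⟩
    rw [mul_comm]
    exact (mul_le_mul_of_nonneg_right (hmax x) hm0).trans ha.1
  obtain ⟨h1, h2⟩ := hN _ hmem
  refine ⟨h1, ?_⟩
  rw [h2, mul_div_cancel₀ _ (hσpos x).ne']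

namespace IsProfileFamily

variable {σ m : ℝ → ℝ} {a₀ b : ℝ} {G : ℝ → ℝ → ℝ}

lemma continuous_comp (hG : IsProfileFamily σ m a₀ b G) (hσc : Continuous σ)
    (hσpos : ∀ x, 0 < σ x) (hm : StrictMonoOn m (Ici 0)) {X : Type*} [TopologicalSpace X]
    {α ξ : X → ℝ} (hα : Continuous α) (hξ : Continuous ξ) (hmem : ∀ t, α t ∈ Ico a₀ b) :
    Continuous fun t => G (α t) (ξ t) := by
  refine continuous_of_strictMonoOn_comp (g := fun t => α t / σ (ξ t)) hm
    (hα.div (hσc.comp hξ) fun t => (hσpos _).ne') (fun t => (hG _ (hmem t) _).1) fun t => ?_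
  rw [eq_div_iff (hσpos _).ne', mul_comm]
  exact (hG _ (hmem t) _).2

lemma continuous (hG : IsProfileFamily σ m a₀ b G) (hσc : Continuous σ)
    (hσpos : ∀ x, 0 < σ x) (hm : StrictMonoOn m (Ici 0)) {a : ℝ} (ha : a ∈ Ico a₀ b) :
    Continuous (G a) :=
  hG.continuous_comp hσc hσpos hm continuous_const continuous_id fun _ => ha

lemma ofReal_integral (hG : IsProfileFamily σ m a₀ b G) (hσc : Continuous σ)
    (hσpos : ∀ x, 0 < σ x) (hm : StrictMonoOn m (Ici 0)) {a : ℝ} (ha : a ∈ Ico a₀ b) :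
    ENNReal.ofReal (∫ z in 0..1, G a z) = ∫⁻ z in Ioc (0 : ℝ) 1, ENNReal.ofReal (G a z) := by
  rw [intervalIntegral.integral_of_le zero_le_one]
  refine ofReal_integral_eq_lintegral_ofReal ?_ (Eventually.of_forall fun x => (hG a ha x).1)
  exact ((hG.continuous hσc hσpos hm ha).intervalIntegrable 0 1).1

lemma exists_lt_integral (hG : IsProfileFamily σ m a₀ b G) (hσc : Continuous σ)
    (hσpos : ∀ x, 0 < σ x) (hm : StrictMonoOn m (Ici 0)) (hab : a₀ < b) {f : ℝ → ENNReal}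
    (hf : ∀ x t, 0 ≤ t → ENNReal.ofReal t < f x → σ x * m t < b) {p : ℝ}
    (hp : ENNReal.ofReal p < ∫⁻ z in Ioc (0 : ℝ) 1, f z) :
    ∃ a ∈ Ico a₀ b, p < ∫ z in 0..1, G a z := by
  obtain ⟨α, -, hα, hαlim⟩ := exists_seq_strictMono_tendsto' hab
  have hmem : ∀ n, α n ∈ Ico a₀ b := fun n => ⟨(hα n).1.le, (hα n).2⟩
  have hle : ∀ x, f x ≤ liminf (fun n => ENNReal.ofReal (G (α n) x)) atTop := by
    intro x
    refine le_of_forall_lt fun t ht => ?_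
    obtain ⟨s, hts, hs⟩ := exists_between ht
    refine hts.trans_le (le_liminf_of_le (by isBoundedDefault) ?_)
    have hs_top : s ≠ ⊤ := hs.ne_top
    have h1 : σ x * m s.toReal < b :=
      hf x _ ENNReal.toReal_nonneg (by rwa [ENNReal.ofReal_toReal hs_top])
    filter_upwards [hαlim.eventually (lt_mem_nhds h1)] with n hn
    rw [← ENNReal.ofReal_toReal hs_top]
    refine ENNReal.ofReal_le_ofReal ?_
    obtain ⟨h2, h3⟩ := hG _ (hmem n) x
    rw [← h3] at hn
    exact ((hm.lt_iff_lt (mem_Ici.2 ENNReal.toReal_nonneg) h2).1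
      (lt_of_mul_lt_mul_left hn (hσpos x).le)).le
  have hlim : ENNReal.ofReal p <
      liminf (fun n => ∫⁻ z in Ioc (0 : ℝ) 1, ENNReal.ofReal (G (α n) z)) atTop :=
    hp.trans_le ((lintegral_mono hle).trans (lintegral_liminf_le fun n =>
      (hG.continuous hσc hσpos hm (hmem n)).measurable.ennreal_ofReal))
  obtain ⟨n, hn⟩ := (eventually_lt_of_lt_liminf hlim).exists
  refine ⟨α n, hmem n, ?_⟩
  rw [← hG.ofReal_integral hσc hσpos hm (hmem n)] at hn
  exact (ENNReal.ofReal_lt_ofReal_iff'.1 hn).1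

lemma exists_isCellSolution1 (hG : IsProfileFamily σ m a₀ b G) (hσc : Continuous σ)
    (hσpos : ∀ x, 0 < σ x) (hm : StrictMonoOn m (Ici 0)) (hGp : ∀ a, IsZPeriodic1 (G a))
    {x₀ : ℝ} (hx₀ : σ x₀ * m 0 = a₀) {a₁ P : ℝ} (ha₁ : a₁ ∈ Ico a₀ b)
    (hP : |P| < ∫ z in 0..1, G a₁ z) :
    ∃ u a, IsCellSolution1 (fun x p => σ x * m |p|) P u a := by
  have ha₀ : a₀ ∈ Ico a₀ b := ⟨le_rfl, ha₁.1.trans_lt ha₁.2⟩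
  have hzero : G a₀ x₀ = 0 := by
    obtain ⟨h1, h2⟩ := hG a₀ ha₀ x₀
    exact hm.injOn h1 (mem_Ici.2 le_rfl)
      (mul_left_cancel₀ (hσpos x₀).ne' (h2.trans hx₀.symm))
  have hshift : ∀ a, ∫ z in x₀..x₀ + 1, G a z = ∫ z in 0..1, G a z := fun a => by
    rw [(hGp a).periodic.intervalIntegral_add_eq x₀ 0, zero_add]
  have hsolve : ∀ a ∈ Ico a₀ b, ∀ c, 0 ≤ c → c ≤ 1 → (G a x₀ = 0 ∨ c = 0 ∨ c = 1) →
      P = (∫ z in x₀..x₀ + c, G a z) - (∫ z in x₀ + c..x₀ + 1, G a z) →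
      ∃ u a, IsCellSolution1 (fun x p => σ x * m |p|) P u a := by
    intro a ha c hc0 hc1 hend h
    obtain ⟨u, hu⟩ := isCellSolution1_of_switch hm.monotoneOn hσpos (fun x => (hG a ha x).1)
      (fun x => (hG a ha x).2) (hG.continuous hσc hσpos hm ha) (hGp a) hc0 hc1 hend h
    exact ⟨u, a, hu⟩
  rcases le_total |P| (∫ z in 0..1, G a₀ z) with hsmall | hbig
  · have hc := hG.continuous hσc hσpos hm ha₀
    have hprim : Continuous fun t => ∫ z in x₀..t, G a₀ z :=
      intervalIntegral.continuous_primitive hc.intervalIntegrable x₀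
    have hsplit : ∀ t, ∫ z in t..x₀ + 1, G a₀ z
        = (∫ z in x₀..x₀ + 1, G a₀ z) - ∫ z in x₀..t, G a₀ z := fun t =>
      (intervalIntegral.integral_interval_sub_left (hc.intervalIntegrable _ _)
        (hc.intervalIntegrable _ _)).symm
    have hcont : Continuous fun c : ℝ =>
        (∫ z in x₀..x₀ + c, G a₀ z) - ∫ z in x₀ + c..x₀ + 1, G a₀ z := by
      have hcomp := hprim.comp (continuous_const_add x₀)
      refine (hcomp.sub (continuous_const (y := ∫ z in x₀..x₀ + 1, G a₀ z) |>.sub hcomp)).congr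
        fun c => ?_
      rw [hsplit (x₀ + c)]
      rfl
    obtain ⟨c, hcI, hcP⟩ := intermediate_value_Icc (zero_le_one' ℝ) hcont.continuousOn
      (show P ∈ _ by
        simp only [add_zero, intervalIntegral.integral_same, hshift, zero_sub, sub_zero]
        exact abs_le.1 hsmall)
    exact hsolve a₀ ha₀ c hcI.1 hcI.2 (Or.inl hzero) hcP.symm
  · set γ : ℝ → ℝ := fun a => max a₀ (min a a₁) with hγ
    have hγc : Continuous γ := by fun_prop
    have hγmem : ∀ a, γ a ∈ Ico a₀ b := fun a =>
      ⟨le_max_left _ _, max_lt ha₀.2 ((min_le_right _ _).trans_lt ha₁.2)⟩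
    have hIc : Continuous fun a => ∫ z in 0..1, G (γ a) z := by
      refine intervalIntegral.continuous_parametric_intervalIntegral_of_continuous'
        (f := fun a z => G (γ a) z) ?_ 0 1
      exact hG.continuous_comp hσc hσpos hm (hγc.comp continuous_fst) continuous_snd
        fun t => hγmem _
    obtain ⟨a, -, ha⟩ := intermediate_value_Icc ha₁.1 hIc.continuousOn
      (show |P| ∈ _ by simpa [hγ, ha₁.1] using ⟨hbig, hP.le⟩)
    replace ha : ∫ z in 0..1, G (γ a) z = |P| := ha
    rcases le_total 0 P with h0 | h0
    · refine hsolve (γ a) (hγmem a) 1 zero_le_one le_rfl (Or.inr (Or.inr rfl)) ?_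
      rw [intervalIntegral.integral_same, hshift, ha, abs_of_nonneg h0, sub_zero]
    · refine hsolve (γ a) (hγmem a) 0 le_rfl zero_le_one (Or.inr (Or.inl rfl)) ?_
      rw [add_zero, intervalIntegral.integral_same, hshift, ha, abs_of_nonpos h0]
      ring

end IsProfileFamily

/-- The one-dimensional solvability set. Here `f : ℝ → ℝ≥0∞`
plays the role of `f_σ̲(x) = m⁻¹(σ̲/σ(x))` (with `m⁻¹(1) = ∞`). -/
theorem onedim_solvability_set
    (σ : ℝ → ℝ) (m : ℝ → ℝ)
    (hσc : Continuous σ) (hσp : IsZPeriodic1 σ) (hσpos : ∀ x, 0 < σ x)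
    (hm01 : ∀ r : ℝ, 0 ≤ r → 0 < m r ∧ m r < 1)
    (hmLip : ∃ L : NNReal, LipschitzOnWith L m (Set.Ici 0))
    (hmmono : StrictMonoOn m (Set.Ici 0))
    (hmlim : Tendsto m atTop (nhds 1))
    (σmax σmin : ℝ)
    (hσmax : IsGreatest (Set.range σ) σmax) (hσmin : IsLeast (Set.range σ) σmin)
    (hcond : σmax * m 0 < σmin)
    (f : ℝ → ENNReal)
    (hf : ∀ x : ℝ,
        (σ x = σmin → f x = ⊤) ∧
        (σ x ≠ σmin → ∃ r : ℝ, 0 ≤ r ∧ m r = σmin / σ x ∧ f x = ENNReal.ofReal r)) :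
    (∫⁻ z in Set.Ioc (0:ℝ) 1, f z ≠ ⊤ →
        { P : ℝ | ∃ (u : ℝ → ℝ) (a : ℝ),
            IsCellSolution1 (fun x p => σ x * m |p|) P u a }
          = Set.Ioo (-(∫⁻ z in Set.Ioc (0:ℝ) 1, f z).toReal)
              (∫⁻ z in Set.Ioc (0:ℝ) 1, f z).toReal) ∧
    (∫⁻ z in Set.Ioc (0:ℝ) 1, f z = ⊤ →
        { P : ℝ | ∃ (u : ℝ → ℝ) (a : ℝ),
            IsCellSolution1 (fun x p => σ x * m |p|) P u a }
          = Set.univ) := by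
  obtain ⟨xmax, hxmax⟩ := hσmax.1
  obtain ⟨xmin, hxmin⟩ := hσmin.1
  have hle_max : ∀ x, σ x ≤ σmax := fun x => hσmax.2 ⟨x, rfl⟩
  have hmin_le : ∀ x, σmin ≤ σ x := fun x => hσmin.2 ⟨x, rfl⟩
  have hmc : ContinuousOn m (Ici 0) := hmLip.choose_spec.continuousOn
  obtain ⟨G, hG, hGp⟩ := exists_isProfileFamily hσp hσpos hle_max hmin_le
    (hm01 0 le_rfl).1.le hmc hmlim
  have hf_lt : ∀ x t, 0 ≤ t → ENNReal.ofReal t < f x → σ x * m t < σmin := by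
    intro x t ht htf
    by_cases hx : σ x = σmin
    · rw [← hx]
      exact mul_lt_of_lt_one_right (hσpos x) (hm01 t ht).2
    · obtain ⟨r, hr0, hr, hfr⟩ := (hf x).2 hx
      rw [hfr] at htf
      have htr : t < r := (ENNReal.ofReal_lt_ofReal_iff_of_nonneg ht).1 htf
      have h1 := hmmono ht hr0 htr
      rw [hr, lt_div_iff₀ (hσpos x)] at h1
      rwa [mul_comm]
  have hf_ge : ∀ a ∈ Ico (σmax * m 0) σmin, ∀ x, ENNReal.ofReal (G a x) ≤ f x := by
    intro a ha x
    by_cases hx : σ x = σmin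
    · rw [(hf x).1 hx]
      exact le_top
    · obtain ⟨r, hr0, hr, hfr⟩ := (hf x).2 hx
      obtain ⟨h1, h2⟩ := hG a ha x
      rw [hfr]
      refine ENNReal.ofReal_le_ofReal ((hmmono.le_iff_le h1 hr0).1 ?_)
      rw [hr, le_div_iff₀ (hσpos x), mul_comm, h2]
      exact ha.2.le
  have hexists : ∀ P : ℝ, ENNReal.ofReal |P| < ∫⁻ z in Ioc (0 : ℝ) 1, f z →
      ∃ u a, IsCellSolution1 (fun x p => σ x * m |p|) P u a := by
    intro P hP
    obtain ⟨a₁, ha₁, hPa⟩ := hG.exists_lt_integral hσc hσpos hmmono hcond hf_lt hP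
    exact hG.exists_isCellSolution1 hσc hσpos hmmono hGp (by rw [hxmax]) ha₁ hPa
  have hbound : ∀ (P : ℝ) (u : ℝ → ℝ) (a : ℝ), IsCellSolution1 (fun x p => σ x * m |p|) P u a →
      ENNReal.ofReal |P| < ∫⁻ z in Ioc (0 : ℝ) 1, f z := by
    intro P u a h
    have ha : a < σmin :=
      hxmin ▸ h.critical_lt hσc hσpos hmmono.monotoneOn (fun r hr => (hm01 r hr).2) xmin
    obtain ⟨b, hb, hbmin⟩ := exists_between (max_lt ha hcond)
    have hbI : b ∈ Ico (σmax * m 0) σmin := ⟨(le_max_right _ _).trans hb.le, hbmin⟩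
    have h1 := h.abs_lt_integral hσpos hmmono.monotoneOn ((le_max_left _ _).trans_lt hb)
      (fun x => (hG b hbI x).1) (fun x => (hG b hbI x).2)
      (hG.continuous hσc hσpos hmmono hbI) (hGp b)
    calc ENNReal.ofReal |P| < ENNReal.ofReal (∫ z in 0..1, G b z) :=
          (ENNReal.ofReal_lt_ofReal_iff_of_nonneg (abs_nonneg P)).2 h1
      _ = ∫⁻ z in Ioc (0 : ℝ) 1, ENNReal.ofReal (G b z) :=
          hG.ofReal_integral hσc hσpos hmmono hbI
      _ ≤ ∫⁻ z in Ioc (0 : ℝ) 1, f z := lintegral_mono (hf_ge b hbI)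
  refine ⟨fun hfin => ?_, fun htop => ?_⟩
  · ext P
    rw [mem_ofPred_eq, mem_Ioo, ← abs_lt, ← ENNReal.ofReal_lt_iff_lt_toReal (abs_nonneg P) hfin]
    exact ⟨fun ⟨u, a, h⟩ => hbound P u a h, hexists P⟩
  · exact eq_univ_of_forall fun P => hexists P (htop ▸ ENNReal.ofReal_lt_top)
end
end

section
/- One-dimensional critical value formula: Let N = 1, assume σ̄ m₀ < σ̲, let P ∈ D and let c be the critical value of the cell problem H(x, u' + P) = a on T. If |P| ≤ ∫₀¹ f_{σ̄ m₀}(z) dz, then c = σ̄ m₀; otherwise c is the unique a ∈ (σ̄ m₀, σ̲) satisfying |P| = ∫₀¹ f_a(z) dz. -/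
open Set Filter MeasureTheory

noncomputable section

/-- `q` is the slope at `x` of a parabola touching `v` from above near `x`. -/
def IsSuperjet (v : ℝ → ℝ) (x q : ℝ) : Prop :=
  ∃ C : ℝ, ∀ᶠ y in nhds x, v y ≤ v x + q * (y - x) + C * (y - x) ^ 2

theorem IsSuperjet.comp_neg {v : ℝ → ℝ} {x q : ℝ} (h : IsSuperjet (fun y => v (-y)) x q) :
    IsSuperjet v (-x) (-q) := by
  obtain ⟨C, hC⟩ := h
  have ht : Tendsto (fun y : ℝ => -y) (nhds (-x)) (nhds x) := by
    simpa using (continuous_neg (G := ℝ)).tendsto (-x)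
  refine ⟨C, (ht.eventually hC).mono fun y hy => ?_⟩
  simp only [neg_neg] at hy
  linarith [hy, (by ring : q * (-y - x) + C * (-y - x) ^ 2 =
    -q * (y - -x) + C * (y - -x) ^ 2)]

theorem IsSuperjet.add_linear {v : ℝ → ℝ} {x q : ℝ} (h : IsSuperjet v x q) (p : ℝ) :
    IsSuperjet (fun y => v y + p * y) x (q + p) := by
  obtain ⟨C, hC⟩ := h
  exact ⟨C, hC.mono fun y hy => by linarith [hy]⟩

theorem IsSuperjet.slope_le {v : ℝ → ℝ} {x q p : ℝ} (h : IsSuperjet v x q)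
    (hp : ∀ y < x, v x + p * (y - x) ≤ v y) : q ≤ p := by
  obtain ⟨C, hC⟩ := h
  obtain ⟨δ, hδ, hball⟩ := Metric.eventually_nhds_iff.1 hC
  by_contra! hlt
  set s : ℝ := min (δ / 2) ((q - p) / (2 * (|C| + 1))) with hs
  have hC0 := abs_nonneg C
  have hs0 : 0 < s := lt_min (by linarith) (by apply div_pos <;> linarith)
  have h1 := hball (y := x - s) (by
    rw [Real.dist_eq]
    have : s ≤ δ / 2 := min_le_left _ _
    rw [show x - s - x = -s by ring, abs_neg, abs_of_pos hs0]
    linarith)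
  have h2 := hp (x - s) (by linarith)
  have h3 : s * (2 * (|C| + 1)) ≤ q - p :=
    (le_div_iff₀ (by linarith)).1 (min_le_right _ _)
  have h4 : (q - p) * s ≤ C * s ^ 2 := by linarith [h1, h2]
  have h5 : C * s ^ 2 ≤ |C| * s ^ 2 := mul_le_mul_of_nonneg_right (le_abs_self C) (by positivity)
  have h6 : 0 < (|C| + 1) * s ^ 2 := by positivity
  nlinarith [mul_le_mul_of_nonneg_right h3 hs0.le]

theorem IsSuperjet.le_slope {v : ℝ → ℝ} {x q p : ℝ} (h : IsSuperjet v x q)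
    (hp : ∀ y > x, v x + p * (y - x) ≤ v y) : p ≤ q := by
  have h' : IsSuperjet (fun y => v (-y)) (-x) (-q) :=
    IsSuperjet.comp_neg (v := fun y => v (-y)) (by simpa using h)
  have := h'.slope_le (p := -p) fun y hy => by
    have := hp (-y) (by linarith)
    simp only [neg_neg]
    linarith
  linarith

theorem IsSuperjet.abs_le_of_lipschitz {v : ℝ → ℝ} {x q K : ℝ} (h : IsSuperjet v x q)
    (hv : ∀ y z, |v y - v z| ≤ K * |y - z|) : |q| ≤ K := by
  refine abs_le.2 ⟨h.le_slope fun y hy => ?_, h.slope_le fun y hy => ?_⟩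
  · have := (abs_le.1 (hv y x)).1
    rw [abs_of_pos (by linarith)] at this
    linarith
  · have := (abs_le.1 (hv y x)).1
    rw [abs_of_neg (by linarith)] at this
    linarith

/-- A mean value inequality: if the chord of `v` over `[x, y]` has slope larger than `k`, then `v`
has a superjet with slope at least `k` close to `[x, y]`. -/
theorem exists_isSuperjet_of_lt {v : ℝ → ℝ} (hv : Continuous v) {x y k δ : ℝ} (hxy : x < y)
    (hδ : 0 < δ) (hk : k * (y - x) < v y - v x) :
    ∃ z ∈ Ioo x (y + δ), ∃ q, k ≤ q ∧ IsSuperjet v z q := by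
  obtain ⟨N, hN0, hN⟩ : ∃ N : ℝ, 0 < N ∧ v (y + δ) - v y - k * δ < N * δ ^ 2 := by
    refine ⟨(|v (y + δ) - v y - k * δ| + 1) / δ ^ 2, by positivity, ?_⟩
    rw [div_mul_cancel₀ _ (by positivity)]
    linarith [le_abs_self (v (y + δ) - v y - k * δ)]
  let h : ℝ → ℝ := fun z => v z - k * z - N * (max (z - y) 0) ^ 2
  have hc : Continuous h := by fun_prop
  have hy : h y = v y - k * y := by simp [h]
  have hx : h x = v x - k * x := by
    simp only [h]; rw [max_eq_right (by linarith)]; ring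
  have hd : h (y + δ) = v (y + δ) - k * (y + δ) - N * δ ^ 2 := by
    simp only [h]; rw [max_eq_left (by linarith)]; ring
  obtain ⟨z, hz, hmax⟩ := isCompact_Icc.exists_isMaxOn
    (nonempty_Icc.2 (by linarith : x ≤ y + δ)) hc.continuousOn
  have hyz : h y ≤ h z := hmax ⟨hxy.le, by linarith⟩
  have hzx : z ≠ x := by rintro rfl; linarith
  have hzd : z ≠ y + δ := by rintro rfl; linarith
  have hz' : z ∈ Ioo x (y + δ) := ⟨lt_of_le_of_ne hz.1 hzx.symm, lt_of_le_of_ne hz.2 hzd⟩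
  refine ⟨z, hz', k + 2 * N * max (z - y) 0, ?_, N, ?_⟩
  · have : 0 ≤ max (z - y) 0 := le_max_right _ _
    nlinarith [mul_nonneg hN0.le this]
  · filter_upwards [Ioo_mem_nhds hz'.1 hz'.2] with w hw
    have hwz : h w ≤ h z := hmax ⟨hw.1.le, hw.2.le⟩
    simp only [h] at hwz
    have key : (max (w - y) 0) ^ 2 ≤
        (max (z - y) 0) ^ 2 + 2 * max (z - y) 0 * (w - z) + (w - z) ^ 2 := by
      rcases max_cases (w - y) 0 with ⟨e, h1⟩ | ⟨e, h1⟩ <;>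
        rcases max_cases (z - y) 0 with ⟨e', h2⟩ | ⟨e', h2⟩ <;> rw [e, e'] <;> nlinarith
    nlinarith [mul_le_mul_of_nonneg_left key hN0.le]

theorem exists_isSuperjet {v : ℝ → ℝ} (hv : Continuous v) {s : Set ℝ} (hs : IsOpen s)
    (hne : s.Nonempty) : ∃ z ∈ s, ∃ q, IsSuperjet v z q := by
  obtain ⟨x, hx⟩ := hne
  obtain ⟨ε, hε, hball⟩ := Metric.isOpen_iff.1 hs x hx
  obtain ⟨z, hz, q, -, hq⟩ := exists_isSuperjet_of_lt hv (x := x) (y := x + ε / 2)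
    (k := (v (x + ε / 2) - v x - 1) / (ε / 2)) (δ := ε / 2) (by linarith) (by linarith)
    (by rw [add_sub_cancel_left, div_mul_cancel₀ _ (by positivity)]; linarith)
  refine ⟨z, hball ?_, q, hq⟩
  rw [Metric.mem_ball, Real.dist_eq, abs_lt]
  constructor <;> linarith [hz.1, hz.2]

theorem sub_le_integral_of_isSuperjet_le {v g : ℝ → ℝ} (hv : Continuous v) (hg : Continuous g)
    (hjet : ∀ x q, IsSuperjet v x q → q ≤ g x) {a b : ℝ} (hab : a ≤ b) :
    v b - v a ≤ ∫ z in a..b, g z := by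
  have := image_le_of_liminf_slope_right_le_deriv_boundary (f := v) (a := a) (b := b)
    hv.continuousOn (B := fun x => v a + ∫ z in a..x, g z) (B' := g) (by simp)
    (by
      refine Continuous.continuousOn ?_
      exact continuous_const.add
        (intervalIntegral.continuous_primitive (fun _ _ => hg.intervalIntegrable _ _) a))
    (fun x _ => ((intervalIntegral.integral_hasDerivAt_right (hg.intervalIntegrable _ _)
      (hg.stronglyMeasurableAtFilter _ _) hg.continuousAt).const_add (v a)).hasDerivWithinAt)
    (fun x _ r hr => by
      obtain ⟨r', hr1, hr2⟩ := exists_between hr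
      obtain ⟨ε, hε, hball⟩ := Metric.eventually_nhds_iff.1
        (hg.continuousAt.eventually (gt_mem_nhds hr1))
      refine Eventually.frequently ?_
      filter_upwards [Ioo_mem_nhdsGT (show x < x + ε / 2 by linarith)] with z hz
      refine lt_of_le_of_lt ?_ hr2
      rw [slope_def_field, div_le_iff₀ (by linarith [hz.1])]
      by_contra! hlt
      obtain ⟨w, hw, q, hq, hjq⟩ := exists_isSuperjet_of_lt hv hz.1
        (show 0 < ε / 2 by linarith) hlt
      have h1 := hball (y := w) (by
        rw [Real.dist_eq, abs_lt]; constructor <;> linarith [hw.1, hw.2, hz.2])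
      linarith [hjet w q hjq])
    (right_mem_Icc.2 hab)
  linarith

theorem strictMono_of_not_isLocalMin {v : ℝ → ℝ} {P : ℝ} (hP : 0 ≤ P) (hv : Continuous v)
    (hvP : ∀ x, v (x + 1) = v x + P) (hmin : ∀ x, ¬ IsLocalMin v x) : StrictMono v := by
  intro a b hab
  by_contra! hba
  have hbd : v b ≤ v (b + 1) := by linarith [hvP b]
  obtain ⟨z, hz, hzmin⟩ := isCompact_Icc.exists_isMinOn
    (nonempty_Icc.2 (by linarith : a ≤ b + 1)) hv.continuousOn
  have interior : ∀ w ∈ Ioo a (b + 1), ¬ IsMinOn v (Icc a (b + 1)) w := fun w hw h =>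
    hmin w (h.isLocalMin (Icc_mem_nhds hw.1 hw.2))
  have hb : v z < v b := by
    by_contra! h
    exact interior b ⟨hab, by linarith⟩ fun w hw => h.trans (hzmin hw)
  refine interior z ⟨lt_of_le_of_ne hz.1 ?_, lt_of_le_of_ne hz.2 ?_⟩ hzmin
  · rintro rfl; linarith
  · rintro rfl; linarith

theorem integral_comp_neg_of_periodic {g : ℝ → ℝ} (hgp : Function.Periodic g 1) :
    ∫ z in (0 : ℝ)..1, g (-z) = ∫ z in (0 : ℝ)..1, g z := by
  have := hgp.intervalIntegral_add_eq (-1) 0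
  rw [intervalIntegral.integral_comp_neg]
  simpa using this

theorem abs_le_integral_of_isSuperjet {v g : ℝ → ℝ} {P : ℝ} (hv : Continuous v)
    (hg : Continuous g) (hgp : Function.Periodic g 1) (hvP : ∀ x, v (x + 1) = v x + P)
    (hjet : ∀ x q, IsSuperjet v x q → |q| ≤ g x) : |P| ≤ ∫ z in (0 : ℝ)..1, g z := by
  refine abs_le'.2 ⟨?_, ?_⟩
  · have h0 := hvP 0
    have := sub_le_integral_of_isSuperjet_le hv hg
      (fun x q h => (le_abs_self q).trans (hjet x q h)) (zero_le_one' ℝ)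
    norm_num at h0
    linarith
  · have h0 := hvP (-1)
    rw [← integral_comp_neg_of_periodic hgp]
    have := sub_le_integral_of_isSuperjet_le (v := fun y => v (-y)) (g := fun y => g (-y))
      (by fun_prop) (by fun_prop) (fun x q h => by
        have := hjet _ _ h.comp_neg
        rw [abs_neg] at this
        exact (le_abs_self q).trans this) (zero_le_one' ℝ)
    norm_num at h0
    rw [neg_zero] at this
    linarith

theorem integral_le_of_isSuperjet_neg {v g : ℝ → ℝ} {P : ℝ} (hP : 0 ≤ P) (hv : Continuous v)
    (hg : Continuous g) (hgpos : ∀ x, 0 < g x) (hvP : ∀ x, v (x + 1) = v x + P)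
    (hjet : ∀ x q, IsSuperjet (fun y => -v y) x q → g x ≤ |q|) :
    ∫ z in (0 : ℝ)..1, g z ≤ P := by
  have hmono : StrictMono v := strictMono_of_not_isLocalMin hP hv hvP fun x hx => by
    have := hjet x 0 ⟨0, hx.mono fun y hy => by linarith⟩
    rw [abs_zero] at this
    linarith [hgpos x]
  have := sub_le_integral_of_isSuperjet_le (v := fun y => -v y) (g := fun y => -g y)
    (by fun_prop) (by fun_prop)
    (fun x q h => by
      have hq : q ≤ 0 := h.slope_le fun y hy => by linarith [hmono hy]
      have := hjet x q h
      rw [abs_of_nonpos hq] at this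
      linarith) (zero_le_one' ℝ)
  rw [intervalIntegral.integral_neg] at this
  have h0 := hvP 0
  norm_num at h0
  linarith

theorem integral_le_abs_of_isSuperjet_neg {v g : ℝ → ℝ} {P : ℝ} (hv : Continuous v)
    (hg : Continuous g) (hgp : Function.Periodic g 1) (hgpos : ∀ x, 0 < g x)
    (hvP : ∀ x, v (x + 1) = v x + P)
    (hjet : ∀ x q, IsSuperjet (fun y => -v y) x q → g x ≤ |q|) :
    ∫ z in (0 : ℝ)..1, g z ≤ |P| := by
  rcases le_total 0 P with hP | hP
  · rw [abs_of_nonneg hP]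
    exact integral_le_of_isSuperjet_neg hP hv hg hgpos hvP hjet
  · rw [abs_of_nonpos hP, ← integral_comp_neg_of_periodic hgp]
    refine integral_le_of_isSuperjet_neg (v := fun y => v (-y)) (by linarith) (by fun_prop)
      (by fun_prop) (fun x => hgpos _) (fun x => ?_) fun x q h => ?_
    · have := hvP (-x - 1)
      rw [sub_add_cancel] at this
      rw [show -(x + 1) = -x - 1 by ring]
      linarith
    · have := hjet _ _ (IsSuperjet.comp_neg (v := fun y => -v y) h)
      rwa [abs_neg] at this

theorem mem_superDiff1_of_isSuperjet {u : ℝ → ℝ} {K : NNReal} (hu : LipschitzWith K u)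
    (hup : IsZPeriodic1 u) {x q : ℝ} (h : IsSuperjet u x q) : q ∈ superDiff1 u x := by
  obtain ⟨C, hC⟩ := h
  obtain ⟨δ, hδ, hball⟩ := Metric.eventually_nhds_iff.1 hC
  have hpi := Real.pi_pos
  set C' : ℝ := |C| + (K + |q|) / δ with hC'
  have hC'0 : 0 ≤ C' := by positivity
  have hquad : ∀ t : ℝ, u (x + t) ≤ u x + q * t + C' * t ^ 2 := fun t => by
    rcases lt_or_ge |t| δ with ht | ht
    · have h1 := hball (y := x + t) (by simpa [Real.dist_eq] using ht)
      rw [add_sub_cancel_left] at h1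
      have : C * t ^ 2 ≤ C' * t ^ 2 := mul_le_mul_of_nonneg_right
        ((le_abs_self C).trans (le_add_of_nonneg_right (by positivity))) (by positivity)
      linarith
    · have h1 : u (x + t) - u x ≤ K * |t| := by
        have := hu.dist_le_mul (x + t) x
        rw [Real.dist_eq, Real.dist_eq, add_sub_cancel_left] at this
        exact (le_abs_self _).trans this
      have h2 : -(q * t) ≤ |q| * |t| := by rw [← abs_mul]; exact neg_le_abs _
      have h3 : (K + |q|) * |t| ≤ (K + |q|) / δ * t ^ 2 := by
        rw [← sq_abs t, div_mul_eq_mul_div, le_div_iff₀ hδ, sq, mul_assoc]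
        exact mul_le_mul_of_nonneg_left (mul_le_mul_of_nonneg_left ht (abs_nonneg t))
          (by positivity)
      have h4 : 0 ≤ |C| * t ^ 2 := by positivity
      rw [hC']
      linarith
  set N : ℝ := C' + 4 * |q| with hN
  have hN0 : 0 ≤ N := by positivity
  let φ : ℝ → ℝ := fun y =>
    q * (Real.sin (2 * Real.pi * (y - x)) / (2 * Real.pi)) + N * Real.sin (Real.pi * (y - x)) ^ 2
  have hφp : IsZPeriodic1 φ := fun y z => by
    have e1 : Real.sin (2 * Real.pi * (y + z - x)) = Real.sin (2 * Real.pi * (y - x)) := by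
      rw [show 2 * Real.pi * (y + z - x) = 2 * Real.pi * (y - x) + z * (2 * Real.pi) by ring,
        Real.sin_add_int_mul_two_pi]
    have e2 : Real.sin (Real.pi * (y + z - x)) ^ 2 = Real.sin (Real.pi * (y - x)) ^ 2 := by
      rw [Real.sin_sq, Real.sin_sq, Real.cos_sq, Real.cos_sq,
        show 2 * (Real.pi * (y + z - x)) = 2 * (Real.pi * (y - x)) + z * (2 * Real.pi) by ring,
        Real.cos_add_int_mul_two_pi]
    simp only [φ, e1, e2]
  have hφx : φ x = 0 := by simp [φ]
  have hle : ∀ t : ℝ, |t| ≤ 1 / 2 → u (x + t) ≤ u x + φ (x + t) := fun t ht => by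
    have h1 : 4 * t ^ 2 ≤ Real.sin (Real.pi * t) ^ 2 := by
      have := Real.mul_abs_le_abs_sin (x := Real.pi * t) (by
        rw [abs_mul, abs_of_pos hpi]; nlinarith)
      rw [abs_mul, abs_of_pos hpi, ← mul_assoc, div_mul_cancel₀ _ hpi.ne'] at this
      have h2 := pow_le_pow_left₀ (by positivity) this 2
      rw [mul_pow, sq_abs, sq_abs] at h2
      linarith
    have h2 : |t - Real.sin (2 * Real.pi * t) / (2 * Real.pi)| ≤ 4 * t ^ 2 := by
      have h3 := Real.abs_sub_sin_le (2 * Real.pi * t)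
      have e : t - Real.sin (2 * Real.pi * t) / (2 * Real.pi) =
          (2 * Real.pi * t - Real.sin (2 * Real.pi * t)) / (2 * Real.pi) := by
        field_simp
      rw [e, abs_div, abs_of_pos (by positivity : 0 < 2 * Real.pi), div_le_iff₀ (by positivity)]
      refine h3.trans ?_
      rw [abs_mul, abs_of_pos (by positivity : 0 < 2 * Real.pi), ← sq_abs t]
      have h4 : Real.pi ^ 2 ≤ 12 := by nlinarith [Real.pi_lt_d2]
      have h5 : Real.pi ^ 2 * |t| ≤ 6 := by nlinarith [abs_nonneg t]
      have h6 : 0 ≤ Real.pi * |t| ^ 2 := by positivity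
      linarith [mul_le_mul_of_nonneg_left h5 h6]
    have h3 : q * t - q * (Real.sin (2 * Real.pi * t) / (2 * Real.pi)) ≤ |q| * (4 * t ^ 2) := by
      rw [← mul_sub]
      refine (le_abs_self _).trans ?_
      rw [abs_mul]
      exact mul_le_mul_of_nonneg_left h2 (abs_nonneg q)
    have h4 := mul_le_mul_of_nonneg_left h1 hN0
    have h5 : 0 ≤ C' * t ^ 2 := by positivity
    have h6 : 0 ≤ |q| * t ^ 2 := by positivity
    simp only [φ, add_sub_cancel_left]
    rw [hN] at h4 ⊢
    linarith [hquad t]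
  refine ⟨φ, by fun_prop, hφp, fun y => ?_, ?_⟩
  · have h1 := hle (y - x - round (y - x)) (abs_sub_round _)
    have e : x + (y - x - round (y - x)) + (round (y - x) : ℤ) = y := by ring
    rw [← hup _ (round (y - x)), ← hφp _ (round (y - x)), e] at h1
    linarith
  · have hd : HasDerivAt (fun y : ℝ => y - x) 1 x := (hasDerivAt_id x).sub_const x
    have h1 := ((((hd.const_mul (2 * Real.pi)).sin).div_const (2 * Real.pi)).const_mul q).add
      ((((hd.const_mul Real.pi).sin).pow 2).const_mul N)
    refine (h1.deriv.trans ?_).symm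
    simp

theorem mem_subDiff1_of_isSuperjet_neg {u : ℝ → ℝ} {K : NNReal} (hu : LipschitzWith K u)
    (hup : IsZPeriodic1 u) {x q : ℝ} (h : IsSuperjet (fun y => -u y) x q) :
    -q ∈ subDiff1 u x := by
  obtain ⟨φ, hφ, hφp, hle, rfl⟩ := mem_superDiff1_of_isSuperjet (u := fun y => -u y) (K := K)
    (LipschitzWith.of_dist_le_mul fun a b => by simpa using hu.dist_le_mul a b)
    (fun y z => by simp only [hup y z]) h
  exact ⟨fun y => -φ y, hφ.neg, fun y z => by simp only [hφp y z],
    fun y => by linarith [hle y], by simp [deriv.fun_neg]⟩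

/-- The inverse of a strictly increasing function, composed with a continuous function. -/
theorem continuous_of_strictMonoOn_comp_s15 {m r : ℝ → ℝ} (hm : StrictMonoOn m (Ici 0))
    (hr : ∀ x, 0 ≤ r x) (hmr : Continuous fun x => m (r x)) : Continuous r := by
  refine OrderTopology.continuous_iff.2 fun a => ?_
  rcases lt_or_ge a 0 with ha | ha
  · constructor
    · convert isOpen_univ
      ext x
      simpa using ha.trans_le (hr x)
    · convert isOpen_empty
      ext x
      simpa using ha.le.trans (hr x)
  · constructor
    · convert (isOpen_Ioi (a := m a)).preimage hmr using 1
      ext x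
      exact (hm.lt_iff_lt ha (hr x)).symm
    · convert (isOpen_Iio (a := m a)).preimage hmr using 1
      ext x
      exact (hm.lt_iff_lt (hr x) ha).symm

theorem lintegral_Ioc_eq_ofReal_integral {F : ℝ → ENNReal} {r : ℝ → ℝ} (hr : Continuous r)
    (hr0 : ∀ x, 0 ≤ r x) (hF : ∀ x, F x = ENNReal.ofReal (r x)) :
    ∫⁻ z in Ioc (0 : ℝ) 1, F z = ENNReal.ofReal (∫ z in (0 : ℝ)..1, r z) := by
  rw [intervalIntegral.integral_of_le zero_le_one,
    ofReal_integral_eq_lintegral_ofReal (hr.integrableOn_Ioc) (ae_of_all _ hr0)]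
  simp only [hF]

/-- One-dimensional critical value formula. Here `f a : ℝ → ℝ≥0∞`
plays the role of `f_a(x) = m⁻¹(a/σ(x))` (with `m⁻¹(1) = ∞`), for
`σ̄ m₀ ≤ a ≤ σ̲`. -/
theorem onedim_critical_value_formula
    (σ : ℝ → ℝ) (m : ℝ → ℝ)
    (hσc : Continuous σ) (hσp : IsZPeriodic1 σ) (hσpos : ∀ x, 0 < σ x)
    (hm01 : ∀ r : ℝ, 0 ≤ r → 0 < m r ∧ m r < 1)
    (hmLip : ∃ L : NNReal, LipschitzOnWith L m (Set.Ici 0))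
    (hmmono : StrictMonoOn m (Set.Ici 0))
    (hmlim : Tendsto m atTop (nhds 1))
    (σmax σmin : ℝ)
    (hσmax : IsGreatest (Set.range σ) σmax) (hσmin : IsLeast (Set.range σ) σmin)
    (hcond : σmax * m 0 < σmin)
    (f : ℝ → ℝ → ENNReal)
    (hf : ∀ a : ℝ, σmax * m 0 ≤ a → a ≤ σmin → ∀ x : ℝ,
        (σ x = a → f a x = ⊤) ∧
        (σ x ≠ a → ∃ r : ℝ, 0 ≤ r ∧ m r = a / σ x ∧ f a x = ENNReal.ofReal r))
    (P : ℝ) (u : ℝ → ℝ) (c : ℝ)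
    (hsol : IsCellSolution1 (fun x p => σ x * m |p|) P u c) :
    (ENNReal.ofReal |P| ≤ ∫⁻ z in Set.Ioc (0:ℝ) 1, f (σmax * m 0) z →
        c = σmax * m 0) ∧
    (¬ ENNReal.ofReal |P| ≤ ∫⁻ z in Set.Ioc (0:ℝ) 1, f (σmax * m 0) z →
        σmax * m 0 < c ∧ c < σmin ∧
        ENNReal.ofReal |P| = ∫⁻ z in Set.Ioc (0:ℝ) 1, f c z ∧
        ∀ a : ℝ, σmax * m 0 < a → a < σmin →
          ENNReal.ofReal |P| = ∫⁻ z in Set.Ioc (0:ℝ) 1, f a z → a = c) := by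
  obtain ⟨⟨K, hK⟩, hup, hsub, hsup⟩ := hsol
  obtain ⟨xmax, hxmax⟩ := hσmax.1
  have hm0 : 0 < m 0 := (hm01 0 le_rfl).1
  have hm_le : ∀ {r s : ℝ}, 0 ≤ r → 0 ≤ s → (m r ≤ m s ↔ r ≤ s) := fun hr hs =>
    hmmono.le_iff_le hr hs
  have hdata : ∀ a, σmax * m 0 ≤ a → a < σmin → ∃ r : ℝ → ℝ, Continuous r ∧
      Function.Periodic r 1 ∧ (∀ x, 0 ≤ r x) ∧ (∀ x, m (r x) = a / σ x) ∧
      ∫⁻ z in Ioc (0 : ℝ) 1, f a z = ENNReal.ofReal (∫ z in (0 : ℝ)..1, r z) := by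
    intro a ha ha'
    choose r hr0 hmr hfr using fun x =>
      (hf a ha ha'.le x).2 (ha'.trans_le (hσmin.2 (mem_range_self x))).ne'
    have hrc : Continuous r := continuous_of_strictMonoOn_comp_s15 hmmono hr0 (by
      simp only [hmr]
      exact continuous_const.div hσc fun x => (hσpos x).ne')
    refine ⟨r, hrc, fun x => hmmono.injOn (hr0 _) (hr0 _) ?_, hr0, hmr,
      lintegral_Ioc_eq_ofReal_integral hrc hr0 hfr⟩
    have := hσp x 1
    rw [Int.cast_one] at this
    rw [hmr, hmr, this]
  have hlt : ∀ {a b : ℝ} {r s : ℝ → ℝ}, a < b → Continuous r → Continuous s →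
      (∀ x, 0 ≤ r x) → (∀ x, 0 ≤ s x) → (∀ x, m (r x) = a / σ x) → (∀ x, m (s x) = b / σ x) →
      ∫ z in (0 : ℝ)..1, r z < ∫ z in (0 : ℝ)..1, s z := by
    intro a b r s hab hr hs hr0 hs0 hmr hms
    have hrs : ∀ x, r x < s x := fun x => (hmmono.lt_iff_lt (hr0 x) (hs0 x)).1 (by
      rw [hmr, hms]
      exact div_lt_div_of_pos_right hab (hσpos x))
    exact intervalIntegral.integral_lt_integral_of_continuousOn_of_le_of_exists_lt zero_lt_one
      hr.continuousOn hs.continuousOn (fun x _ => (hrs x).le)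
      ⟨0, left_mem_Icc.2 zero_le_one, hrs 0⟩
  set v : ℝ → ℝ := fun y => u y + P * y with hvdef
  have huc : Continuous u := hK.continuous
  have hvc : Continuous v := by fun_prop
  have hvP : ∀ x, v (x + 1) = v x + P := fun x => by
    have := hup x 1
    rw [Int.cast_one] at this
    simp only [hvdef, this]
    ring
  have hvsub : ∀ x q, IsSuperjet v x q → σ x * m |q| ≤ c := fun x q h => by
    have h1 := hsub x _ (mem_superDiff1_of_isSuperjet (q := q - P) hK hup (by
      have := h.add_linear (-P)
      simpa [hvdef, sub_eq_add_neg] using this))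
    simpa using h1
  have hvsup : ∀ x q, IsSuperjet (fun y => -v y) x q → c ≤ σ x * m |q| := fun x q h => by
    have h1 := hsup x _ (mem_subDiff1_of_isSuperjet_neg (q := q + P) hK hup (by
      have := h.add_linear P
      convert this using 2
      simp only [hvdef]
      ring))
    simp only at h1
    rwa [show -(q + P) + P = -q by ring, abs_neg] at h1
  have hc0 : σmax * m 0 ≤ c := by
    by_contra! hlt'
    obtain ⟨z, hz, q, hq⟩ := exists_isSuperjet hvc
      (isOpen_lt continuous_const (hσc.mul continuous_const) : IsOpen {x | c < σ x * m 0})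
      ⟨xmax, by simpa [hxmax] using hlt'⟩
    have h1 := hvsub z q hq
    have h2 := mul_le_mul_of_nonneg_left ((hm_le le_rfl (abs_nonneg q)).2 (abs_nonneg q))
      (hσpos z).le
    have h3 : c < σ z * m 0 := hz
    linarith
  have hc1 : c < σmin := by
    obtain ⟨xmin, hxmin⟩ := hσmin.1
    set L : ℝ := K + |P|
    have hL : 0 ≤ L := by positivity
    have hvL : ∀ y z, |(-v y) - (-v z)| ≤ L * |y - z| := fun y z => by
      have h1 := hK.dist_le_mul y z
      rw [Real.dist_eq, Real.dist_eq] at h1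
      calc |(-v y) - (-v z)| = |-((u y - u z) + P * (y - z))| := by
            simp only [hvdef]; congr 1; ring
        _ ≤ |u y - u z| + |P * (y - z)| := by rw [abs_neg]; exact abs_add_le _ _
        _ ≤ L * |y - z| := by rw [abs_mul]; linarith
    have hle : c ≤ σmin * m L := by
      by_contra! hlt'
      obtain ⟨z, hz, q, hq⟩ := exists_isSuperjet hvc.neg
        (isOpen_lt (hσc.mul continuous_const) continuous_const : IsOpen {x | σ x * m L < c})
        ⟨xmin, by simpa [hxmin] using hlt'⟩
      have h1 := hvsup z q hq
      have h2 := mul_le_mul_of_nonneg_left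
        ((hm_le (abs_nonneg q) hL).2 (hq.abs_le_of_lipschitz hvL)) (hσpos z).le
      have h3 : σ z * m L < c := hz
      linarith
    have : 0 < σmin := hxmin ▸ hσpos xmin
    nlinarith [(hm01 L hL).2]
  obtain ⟨r, hrc, hrp, hr0, hmr, hfr⟩ := hdata c hc0 hc1
  obtain ⟨s, hsc, -, hs0, hms, hfs⟩ := hdata (σmax * m 0) le_rfl hcond
  have hint0 : ∀ {w : ℝ → ℝ}, (∀ x, 0 ≤ w x) → 0 ≤ ∫ z in (0 : ℝ)..1, w z := fun hw =>
    intervalIntegral.integral_nonneg zero_le_one fun x _ => hw x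
  have hPle : |P| ≤ ∫ z in (0 : ℝ)..1, r z :=
    abs_le_integral_of_isSuperjet hvc hrc hrp hvP fun x q h => by
      rw [← hm_le (abs_nonneg q) (hr0 x), hmr, le_div_iff₀' (hσpos x)]
      exact hvsub x q h
  have hPeq : σmax * m 0 < c → |P| = ∫ z in (0 : ℝ)..1, r z := fun hgt =>
    hPle.antisymm <| integral_le_abs_of_isSuperjet_neg hvc hrc hrp
      (fun x => (hmmono.lt_iff_lt self_mem_Ici (hr0 x)).1 (by
        rw [hmr, lt_div_iff₀' (hσpos x)]
        exact (mul_le_mul_of_nonneg_right (hσmax.2 (mem_range_self x)) hm0.le).trans_lt hgt))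
      hvP fun x q h => by
        rw [← hm_le (hr0 x) (abs_nonneg q), hmr, div_le_iff₀' (hσpos x)]
        exact hvsup x q h
  rw [hfs, ENNReal.ofReal_le_ofReal_iff (hint0 hs0)]
  refine ⟨fun h => ?_, fun h => ?_⟩
  · by_contra hne
    have hgt := lt_of_le_of_ne hc0 (Ne.symm hne)
    linarith [hPeq hgt, hlt hgt hsc hrc hs0 hr0 hms hmr]
  · have hgt : σmax * m 0 < c := lt_of_le_of_ne hc0 fun heq => h (by
      have hsr : s = r := funext fun x => hmmono.injOn (hs0 x) (hr0 x) (by rw [hms, hmr, heq])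
      rwa [hsr])
    refine ⟨hgt, hc1, by rw [hfr, hPeq hgt], fun a ha ha' haP => ?_⟩
    obtain ⟨w, hwc, -, hw0, hmw, hfw⟩ := hdata a ha.le ha'
    rw [hfw, ENNReal.ofReal_eq_ofReal_iff (abs_nonneg P) (hint0 hw0), hPeq hgt] at haP
    rcases lt_trichotomy a c with hac | hac | hac
    · exact absurd haP (hlt hac hwc hrc hw0 hr0 hmw hmr).ne'
    · exact hac
    · exact absurd haP (hlt hac hrc hwc hr0 hw0 hmr hmw).ne
end
end
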